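/- arXiv:1910.06839 — 2 statements merged into one kernel-verified Lean document; each statement's English description precedes it below -/
import Mathlib

section
/- Local two-weight Sobolev–Poincaré inequality: let Q_0 ⊂ ℝ^n be a cube, 1 < p ≤ q < ∞, and (v, w) a pair of weights on Q_0 such that w ∈ A_∞^d(Q_0) with constants C_w, δ_w > 0 and σ = v^{−1/(p−1)} ∈ A_∞^d(Q_0) with constants C_σ, δ_σ > 0. Suppose there exists K > 0 such that |Q|^{−(1−1/n)p} w(Q)^{p/q} σ(Q)^{p−1} ≤ K for all dyadic cubes Q ∈ D(Q_0). Then there is a constant C = C(n, p, q, K, C_w, C_σ, δ_w, δ_σ) > 0 such that for every u ∈ Lip(Q_0), (∫_{Q_0} |u(x) − u_{Q_0}|^q w(x) dx)^{1/q} ≤ C (∫_{Q_0} |∇u(x)|^p v(x) dx)^{1/p}. -/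
open MeasureTheory ENNReal NNReal Set

noncomputable section

/-- Euclidean space `ℝ^n`. -/
abbrev Rn (n : ℕ) := EuclideanSpace ℝ (Fin n)

/-- The half-open cube with lower corner `a` and side length `l`:
`Q = [a₁, a₁+l) × … × [aₙ, aₙ+l)`. -/
def Cube {n : ℕ} (a : Rn n) (l : ℝ) : Set (Rn n) :=
  {x | ∀ i, a i ≤ x i ∧ x i < a i + l}

/-- `IsDyadicSub a l Q` : `Q` belongs to the collection `D(Q₀)` of dyadic subcubes of the cube
`Q₀ = Cube a l`, i.e. `Q₀` together with all cubes obtained from `Q₀` by recursively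
bisecting each edge. -/
def IsDyadicSub {n : ℕ} (a : Rn n) (l : ℝ) (Q : Set (Rn n)) : Prop :=
  ∃ (k : ℕ) (m : Fin n → ℕ), (∀ i, m i < 2 ^ k) ∧
    Q = {x : Rn n | ∀ i, a i + l * m i / 2 ^ k ≤ x i ∧ x i < a i + l * m i / 2 ^ k + l / 2 ^ k}

/-- The weighted measure `w(E) = ∫_E w dx` of a set, as an extended nonnegative real. -/
def wMass {n : ℕ} (w : Rn n → ℝ) (E : Set (Rn n)) : ℝ≥0∞ :=
  ∫⁻ x in E, ENNReal.ofReal (w x)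

/-- The dyadic Muckenhoupt `A_∞` condition on `Q₀ = Cube a l` with constants `Cw, δw`. -/
def IsAinftyD {n : ℕ} (a : Rn n) (l : ℝ) (w : Rn n → ℝ) (Cw δw : ℝ) : Prop :=
  ∀ Q : Set (Rn n), IsDyadicSub a l Q → ∀ E : Set (Rn n), MeasurableSet E → E ⊆ Q →
    wMass w E ≤ ENNReal.ofReal Cw * (volume E / volume Q) ^ δw * wMass w Q

section Fibers

theorem factorsThrough_of_le {Ω ι : Type*} {c : ℕ → Ω → ι}
    (hr : ∀ k, (c k).FactorsThrough (c (k + 1))) {j k : ℕ} (hjk : j ≤ k) :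
    (c j).FactorsThrough (c k) := by
  induction k, hjk using Nat.le_induction with
  | base => exact fun x y h => h
  | succ k _ ih => exact fun x y h => ih (hr k h)

/-- The average of the measure `H` with respect to `ν` over the cell of `x` at level `k`. -/
def cellAverage {Ω ι : Type*} [MeasurableSpace Ω] (c : ℕ → Ω → ι) (ν H : Measure Ω)
    (k : ℕ) (x : Ω) : ℝ≥0∞ :=
  H {y | c k y = c k x} / ν {y | c k y = c k x}

theorem cellAverage_factorsThrough {Ω ι : Type*} [MeasurableSpace Ω] (c : ℕ → Ω → ι)
    (ν H : Measure Ω) (k : ℕ) :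
    (cellAverage c ν H k).FactorsThrough (c k) := by
  intro x y h
  simp only [cellAverage, h]

variable {Ω ι : Type*} [MeasurableSpace Ω] [MeasurableSpace ι] [Countable ι]
  [MeasurableSingletonClass ι]

theorem measurable_of_factorsThrough {c : Ω → ι} (hc : Measurable c) {φ : Ω → ℝ≥0∞}
    (hφ : φ.FactorsThrough c) : Measurable φ := by
  rw [← hφ.extend_comp (e' := fun _ => 0)]
  exact (measurable_of_countable _).comp hc

theorem measurableSet_of_saturated {c : Ω → ι} (hc : Measurable c) {S : Set Ω}
    (hS : ∀ x y, c x = c y → x ∈ S → y ∈ S) : MeasurableSet S := by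
  have : S = c ⁻¹' (c '' S) := by
    refine Subset.antisymm (subset_preimage_image c S) ?_
    rintro y ⟨x, hx, hxy⟩
    exact hS x y hxy hx
  rw [this]
  exact hc (Set.to_countable _).measurableSet

/-- Two integrals of functions that are constant on the fibers of `c` can be compared fiber by
fiber. -/
theorem lintegral_le_of_fiber {c : Ω → ι} (hc : Measurable c) {φ ψ : Ω → ℝ≥0∞}
    (hφ : φ.FactorsThrough c) (hψ : ψ.FactorsThrough c) {μ₁ μ₂ : Measure Ω}
    (h : ∀ x, φ x * μ₁ {y | c y = c x} ≤ ψ x * μ₂ {y | c y = c x}) :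
    ∫⁻ x, φ x ∂μ₁ ≤ ∫⁻ x, ψ x ∂μ₂ := by
  have key : ∀ {φ : Ω → ℝ≥0∞}, φ.FactorsThrough c → ∀ μ : Measure Ω, ∫⁻ x, φ x ∂μ =
      ∑' i, Function.extend c φ (fun _ => 0) i * μ (c ⁻¹' {i}) := by
    intro φ hφ μ
    conv_lhs => rw [← hφ.extend_comp (e' := fun _ => 0)]
    simp only [Function.comp_apply]
    rw [← lintegral_map (measurable_of_countable _) hc, lintegral_countable']
    refine tsum_congr fun i => ?_
    rw [Measure.map_apply hc (measurableSet_singleton i)]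
  rw [key hφ, key hψ]
  refine ENNReal.tsum_le_tsum fun i => ?_
  by_cases hi : ∃ x, c x = i
  · obtain ⟨x, rfl⟩ := hi
    rw [hφ.extend_apply, hψ.extend_apply]
    exact h x
  · rw [Function.extend_apply' _ _ _ hi]
    simp

/-- Weak-type estimate for the maximal function of cell averages. -/
theorem mul_measure_exists_lt_cellAverage_le {c : ℕ → Ω → ι} (hc : ∀ k, Measurable (c k))
    (hr : ∀ k, (c k).FactorsThrough (c (k + 1))) (ν H : Measure Ω) (k : ℕ) (t : ℝ≥0∞)
    {Q : Set Ω} (hQ : ∀ x y, c k x = c k y → x ∈ Q → y ∈ Q) :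
    t * ν (Q ∩ {x | ∃ j, t < cellAverage c ν H (k + j) x}) ≤ H Q := by
  set F : ℕ → Set Ω := fun j => Q ∩ {x | t < cellAverage c ν H (k + j) x} with hF
  have hsat : ∀ j x y, c (k + j) x = c (k + j) y → x ∈ F j → y ∈ F j := by
    rintro j x y hxy ⟨h1, h2⟩
    refine ⟨hQ x y (factorsThrough_of_le hr (Nat.le_add_right k j) hxy) h1, ?_⟩
    simpa only [mem_ofPred_eq, cellAverage_factorsThrough c ν H (k + j) hxy] using h2
  have hsat' : ∀ j x y, c (k + j) x = c (k + j) y → x ∈ disjointed F j → y ∈ disjointed F j := by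
    intro j x y hxy hx
    rw [disjointed_eq_inter_compl] at hx ⊢
    refine ⟨hsat j x y hxy hx.1, ?_⟩
    have hx2 := hx.2
    simp only [mem_iInter, mem_compl_iff] at hx2 ⊢
    intro i hi hy
    refine hx2 i hi (hsat i y x ?_ hy)
    exact factorsThrough_of_le hr (by omega) hxy.symm
  have hmeas : ∀ j, MeasurableSet (disjointed F j) := fun j =>
    measurableSet_of_saturated (hc (k + j)) (hsat' j)
  have hone : ∀ j, t * ν (disjointed F j) ≤ H (disjointed F j) := by
    intro j
    have hfac : ∀ s : ℝ≥0∞, ((disjointed F j).indicator fun _ => s).FactorsThrough (c (k + j)) := by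
      intro s x y hxy
      by_cases hx : x ∈ disjointed F j
      · simp [hx, hsat' j x y hxy hx]
      · have hy : y ∉ disjointed F j := fun hy => hx (hsat' j y x hxy.symm hy)
        simp [hx, hy]
    have := lintegral_le_of_fiber (hc (k + j)) (hfac t) (hfac 1) (μ₁ := ν) (μ₂ := H) (by
      intro x
      by_cases hx : x ∈ disjointed F j
      · simp only [indicator_of_mem hx, one_mul]
        exact ENNReal.mul_le_of_le_div (disjointed_subset F j hx).2.le
      · simp [hx])
    simpa [lintegral_indicator_const (hmeas j)] using this
  have hU : Q ∩ {x | ∃ j, t < cellAverage c ν H (k + j) x} = ⋃ j, disjointed F j := by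
    rw [iUnion_disjointed]
    ext x
    simp [hF]
  rw [hU, measure_iUnion (disjoint_disjointed F) hmeas, ← ENNReal.tsum_mul_left]
  calc ∑' j, t * ν (disjointed F j) ≤ ∑' j, H (disjointed F j) := ENNReal.tsum_le_tsum hone
    _ = H (⋃ j, disjointed F j) := (measure_iUnion (disjoint_disjointed F) hmeas).symm
    _ ≤ H Q := measure_mono (by rw [← hU]; exact inter_subset_left)

end Fibers

section Principal

/-- The running principal value of a sequence: it is updated whenever the sequence exceeds `A`
times its current value. -/
def principalValue (A : ℝ≥0∞) (g : ℕ → ℝ≥0∞) : ℕ → ℝ≥0∞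
  | 0 => g 0
  | k + 1 => if A * principalValue A g k < g (k + 1) then g (k + 1) else principalValue A g k

/-- The indices at which the principal value of a sequence is updated. -/
def IsPrincipal (A : ℝ≥0∞) (g : ℕ → ℝ≥0∞) : ℕ → Prop
  | 0 => True
  | k + 1 => A * principalValue A g k < g (k + 1)

variable {A : ℝ≥0∞} {g : ℕ → ℝ≥0∞}

theorem IsPrincipal.principalValue_eq {k : ℕ} (h : IsPrincipal A g k) :
    principalValue A g k = g k := by
  cases k with
  | zero => rfl
  | succ k => exact if_pos h

theorem le_mul_principalValue (hA : 1 ≤ A) (k : ℕ) : g k ≤ A * principalValue A g k := by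
  cases k with
  | zero => exact le_mul_of_one_le_left' hA
  | succ k =>
    rw [principalValue]
    split_ifs with h
    · exact le_mul_of_one_le_left' hA
    · exact not_lt.1 h

theorem monotone_principalValue (hA : 1 ≤ A) : Monotone (principalValue A g) := by
  refine monotone_nat_of_le_succ fun k => ?_
  rw [principalValue]
  split_ifs with h
  · exact (le_mul_of_one_le_left' hA).trans h.le
  · exact le_rfl

theorem IsPrincipal.mul_lt (hA : 1 ≤ A) {j k : ℕ} (hj : IsPrincipal A g j)
    (hk : IsPrincipal A g k) (hjk : j < k) : A * g j < g k := by
  cases k with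
  | zero => omega
  | succ k =>
    refine lt_of_le_of_lt ?_ hk
    rw [← hj.principalValue_eq]
    gcongr
    exact monotone_principalValue hA (by omega)

theorem principalValue_congr {g' : ℕ → ℝ≥0∞} {k : ℕ} (h : ∀ j ≤ k, g j = g' j) :
    principalValue A g k = principalValue A g' k := by
  induction k with
  | zero => exact h 0 le_rfl
  | succ k ih =>
    simp only [principalValue]
    rw [ih fun j hj => h j (by omega), h (k + 1) le_rfl]

theorem isPrincipal_congr {g' : ℕ → ℝ≥0∞} {k : ℕ} (h : ∀ j ≤ k, g j = g' j) :
    IsPrincipal A g k ↔ IsPrincipal A g' k := by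
  cases k with
  | zero => rfl
  | succ k =>
    simp only [IsPrincipal]
    rw [principalValue_congr fun j hj => h j (by omega), h (k + 1) le_rfl]

open Classical in
theorem sum_mul_principalValue_le {t : ℕ → ℝ≥0∞} (ht : ∀ k, 2 * t (k + 1) = t k) (N : ℕ) :
    ∑ k ∈ Finset.range (N + 1), t k * principalValue A g k + t N * principalValue A g N ≤
      2 * ∑ k ∈ Finset.range (N + 1), if IsPrincipal A g k then t k * g k else 0 := by
  induction N with
  | zero => simp [IsPrincipal, principalValue, two_mul]
  | succ N ih =>
    rw [Finset.sum_range_succ, Finset.sum_range_succ (n := N + 1), mul_add, add_assoc, ← two_mul]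
    by_cases h : IsPrincipal A g (N + 1)
    · rw [if_pos h, h.principalValue_eq]
      gcongr
      exact le_self_add.trans ih
    · have h' : principalValue A g (N + 1) = principalValue A g N := if_neg h
      rw [if_neg h, h', mul_zero, add_zero, ← mul_assoc, ht]
      exact ih

open Classical in
theorem sum_mul_le_sum_isPrincipal (hA : 1 ≤ A) {t : ℕ → ℝ≥0∞} (ht : ∀ k, 2 * t (k + 1) = t k)
    (N : ℕ) :
    ∑ k ∈ Finset.range N, t k * g k ≤
      2 * A * ∑ k ∈ Finset.range N, if IsPrincipal A g k then t k * g k else 0 := by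
  cases N with
  | zero => simp
  | succ N =>
    calc ∑ k ∈ Finset.range (N + 1), t k * g k
        ≤ A * ∑ k ∈ Finset.range (N + 1), t k * principalValue A g k := by
          rw [Finset.mul_sum]
          refine Finset.sum_le_sum fun k _ => ?_
          rw [mul_left_comm]
          gcongr
          exact le_mul_principalValue hA k
      _ ≤ A * (2 * ∑ k ∈ Finset.range (N + 1), if IsPrincipal A g k then t k * g k else 0) := by
          gcongr
          exact le_self_add.trans (sum_mul_principalValue_le ht N)
      _ = _ := by ring

end Principal

section Sparse

/-- The constant in the norm estimate for sparse sums. -/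
def sparseConst (r : ℝ) : ℝ≥0∞ :=
  2 * (ENNReal.ofReal (1 - (3 / 4 : ℝ) ^ (1 / r))⁻¹) ^ r

theorem sparseConst_ne_top {r : ℝ} (hr : 0 < r) : sparseConst r ≠ ∞ :=
  ENNReal.mul_ne_top (by simp) (ENNReal.rpow_ne_top_of_nonneg hr.le ENNReal.ofReal_ne_top)

theorem sparseConst_ne_zero {r : ℝ} (hr : 0 < r) : sparseConst r ≠ 0 := by
  have : (3 / 4 : ℝ) ^ (1 / r) < 1 :=
    Real.rpow_lt_one (by norm_num) (by norm_num) (by positivity)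
  refine mul_ne_zero (by simp) (ENNReal.rpow_pos ?_ ENNReal.ofReal_ne_top).ne'
  simpa using this

theorem add_rpow_le_of_pos {r : ℝ} (hr : 0 < r) (t a : ℝ≥0∞) :
    (t + a) ^ r ≤ t ^ r + sparseConst r / 2 * a ^ r + 4⁻¹ * (t + a) ^ r := by
  set s : ℝ := (3 / 4 : ℝ) ^ (1 / r) with hs
  have hs0 : 0 < s := by positivity
  have hs1 : s < 1 := Real.rpow_lt_one (by norm_num) (by norm_num) (by positivity)
  have hconst : sparseConst r / 2 = (ENNReal.ofReal (1 - s)⁻¹) ^ r := by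
    rw [sparseConst, mul_comm, ENNReal.mul_div_cancel_right (by simp) (by simp)]
  rw [hconst]
  rcases le_or_gt (ENNReal.ofReal s * (t + a)) t with h | h
  · have h34 : (ENNReal.ofReal s) ^ r = 3 / 4 := by
      rw [ENNReal.ofReal_rpow_of_pos hs0, hs, ← Real.rpow_mul (by norm_num),
        one_div_mul_cancel hr.ne', Real.rpow_one, ENNReal.ofReal_div_of_pos (by norm_num)]
      simp
    have h1 : 3 / 4 * (t + a) ^ r ≤ t ^ r := by
      rw [← h34, ← ENNReal.mul_rpow_of_nonneg _ _ hr.le]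
      exact ENNReal.rpow_le_rpow h hr.le
    have h2 : (3 / 4 + 4⁻¹ : ℝ≥0∞) = 1 := by
      rw [← one_div, ENNReal.div_add_div_same]
      norm_num
      exact ENNReal.div_self (by norm_num) (by norm_num)
    calc (t + a) ^ r = 3 / 4 * (t + a) ^ r + 4⁻¹ * (t + a) ^ r := by
          rw [← add_mul, h2, one_mul]
      _ ≤ t ^ r + 4⁻¹ * (t + a) ^ r := by gcongr
      _ ≤ _ := by gcongr; exact le_self_add
  · have hle : t + a ≤ ENNReal.ofReal (1 - s)⁻¹ * a := by
      rcases eq_or_ne a ∞ with rfl | ha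
      · rw [ENNReal.mul_top]
        · exact le_top
        · simpa using hs1
      have ht : t ≠ ∞ := h.ne_top
      replace h := h.le
      lift a to ℝ≥0 using ha
      lift t to ℝ≥0 using ht
      rw [← ENNReal.toReal_le_toReal (by finiteness) (by finiteness)] at h ⊢
      rw [ENNReal.toReal_mul, ENNReal.toReal_add (by simp) (by simp)] at *
      rw [ENNReal.toReal_ofReal (by positivity)] at h
      rw [ENNReal.toReal_ofReal (by rw [inv_nonneg]; linarith)]
      rw [inv_mul_eq_div, le_div_iff₀ (by linarith)]
      nlinarith
    calc (t + a) ^ r ≤ (ENNReal.ofReal (1 - s)⁻¹ * a) ^ r := ENNReal.rpow_le_rpow hle hr.le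
      _ = (ENNReal.ofReal (1 - s)⁻¹) ^ r * a ^ r := ENNReal.mul_rpow_of_nonneg _ _ hr.le
      _ ≤ _ := le_add_self.trans le_self_add


theorem le_two_mul_of_le_add_half {X B : ℝ≥0∞} (hX : X ≠ ∞) (h : X ≤ B + X / 2) : X ≤ 2 * B := by
  have h1 : X / 2 ≤ B := by
    have hX2 : X / 2 ≠ ∞ := ENNReal.div_ne_top hX (by simp)
    refine (ENNReal.add_le_add_iff_right hX2).1 ?_
    rwa [ENNReal.add_halves]
  calc X = 2 * (X / 2) := (ENNReal.mul_div_cancel (by simp) (by simp)).symm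
    _ ≤ 2 * B := by gcongr

theorem measurableSet_cell {Ω ι : Type*} [MeasurableSpace Ω] [MeasurableSpace ι]
    [MeasurableSingletonClass ι] {c : Ω → ι} (hc : Measurable c) (x : Ω) :
    MeasurableSet {y | c y = c x} :=
  hc (measurableSet_singleton (c x))

theorem indicator_factorsThrough {Ω ι : Type*} {c : Ω → ι} {S : Set Ω}
    (hS : ∀ x y, c x = c y → x ∈ S → y ∈ S) {φ : Ω → ℝ≥0∞} (hφ : φ.FactorsThrough c) :
    (S.indicator φ).FactorsThrough c := by
  intro x y hxy
  by_cases hx : x ∈ S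
  · rw [indicator_of_mem hx, indicator_of_mem (hS x y hxy hx), hφ hxy]
  · rw [indicator_of_notMem hx, indicator_of_notMem fun hy => hx (hS y x hxy.symm hy)]

variable {Ω ι : Type*} [MeasurableSpace Ω] [MeasurableSpace ι] [Countable ι]
  [MeasurableSingletonClass ι]

/-- The `L^r` norm of a sum of functions adapted to a sparse family is controlled by the `ℓ^r` sum
of the `L^r` norms. -/
theorem lintegral_sum_rpow_le_of_sparse {c : ℕ → Ω → ι} (hc : ∀ k, Measurable (c k))
    (hr : ∀ k, (c k).FactorsThrough (c (k + 1))) {μ : Measure Ω} {r : ℝ} (hr1 : 1 ≤ r)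
    {S E : ℕ → Set Ω} (hS : ∀ k x y, c k x = c k y → x ∈ S k → y ∈ S k)
    (hE : ∀ k, MeasurableSet (E k)) (hdisj : Pairwise (Function.onFun Disjoint E))
    (hsp : ∀ k, ∀ x ∈ S k, μ {y | c k y = c k x} ≤ 2 * μ ({y | c k y = c k x} ∩ E k))
    {a : ℕ → Ω → ℝ≥0∞} (ha : ∀ k, (a k).FactorsThrough (c k))
    (ha0 : ∀ k, ∀ x ∉ S k, a k x = 0) (N : ℕ) :
    ∫⁻ x, (∑ k ∈ Finset.range N, a k x) ^ r ∂μ ≤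
      sparseConst r * ∑ k ∈ Finset.range N, ∫⁻ x, a k x ^ r ∂μ := by
  have hr0 : 0 < r := by linarith
  set T : ℕ → Ω → ℝ≥0∞ := fun N x => ∑ k ∈ Finset.range N, a k x with hT
  have ham : ∀ k, Measurable (a k) := fun k => measurable_of_factorsThrough (hc k) (ha k)
  have hTm : ∀ k, Measurable (T k) := fun k => by
    simp only [hT]
    exact Finset.measurable_fun_sum _ fun j _ => ham j
  have hTfac : ∀ k, (fun x => T (k + 1) x ^ r).FactorsThrough (c k) := by
    intro k x y hxy
    simp only [hT]
    congr 1
    refine Finset.sum_congr rfl fun j hj => ha j ?_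
    exact factorsThrough_of_le hr (by simpa [Nat.lt_succ_iff] using hj) hxy
  have hSm : ∀ k, MeasurableSet (S k) := fun k => measurableSet_of_saturated (hc k) (hS k)
  set Y := ∑ k ∈ Finset.range N, ∫⁻ x, a k x ^ r ∂μ with hY
  rcases eq_or_ne Y ∞ with hYtop | hYtop
  · rw [hYtop, ENNReal.mul_top]
    · exact le_top
    · exact sparseConst_ne_zero hr0
  set X := ∫⁻ x, T N x ^ r ∂μ with hX
  have hXtop : X ≠ ∞ := by
    have h1 : X ≤ ∫⁻ x, (Finset.range N).card ^ (r - 1) *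
        ∑ k ∈ Finset.range N, a k x ^ r ∂μ :=
      lintegral_mono fun x => ENNReal.rpow_sum_le_const_mul_sum_rpow _ _ hr1
    rw [lintegral_const_mul _ (Finset.measurable_fun_sum _ fun j _ => (ham j).pow_const r),
      lintegral_finsetSum _ fun j _ => (ham j).pow_const r] at h1
    refine ne_top_of_le_ne_top (ENNReal.mul_ne_top ?_ hYtop) h1
    exact ENNReal.rpow_ne_top_of_nonneg (by linarith) (by simp)
  have hpt : ∀ M x, T M x ^ r ≤ ∑ k ∈ Finset.range M, (sparseConst r / 2 * a k x ^ r +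
      4⁻¹ * (S k).indicator (fun x => T (k + 1) x ^ r) x) := by
    intro M x
    induction M with
    | zero => simp [hT, hr0]
    | succ M ih =>
      rw [Finset.sum_range_succ]
      have hsucc : T (M + 1) x = T M x + a M x := Finset.sum_range_succ _ _
      by_cases hx : x ∈ S M
      · rw [indicator_of_mem hx, hsucc]
        refine (add_rpow_le_of_pos hr0 _ _).trans ?_
        rw [← add_assoc]
        gcongr
      · rw [hsucc, ha0 M x hx, add_zero]
        exact ih.trans le_self_add
  have hone : ∀ k, ∫⁻ x, (S k).indicator (fun x => T (k + 1) x ^ r) x ∂μ ≤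
      2 * ∫⁻ x in E k, T (k + 1) x ^ r ∂μ := by
    intro k
    rw [← lintegral_const_mul _ ((hTm _).pow_const r)]
    refine lintegral_le_of_fiber (hc k) (indicator_factorsThrough (hS k) (hTfac k))
      (fun x y hxy => congrArg (2 * ·) (hTfac k hxy)) fun x => ?_
    by_cases hx : x ∈ S k
    · rw [indicator_of_mem hx, Measure.restrict_apply (measurableSet_cell (hc k) x)]
      calc _ ≤ T (k + 1) x ^ r * (2 * μ ({y | c k y = c k x} ∩ E k)) := by
            gcongr; exact hsp k x hx
        _ = _ := by ring
    · simp [hx]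
  have hsum : ∑ k ∈ Finset.range N, ∫⁻ x in E k, T (k + 1) x ^ r ∂μ ≤ X := by
    calc _ ≤ ∑ k ∈ Finset.range N, ∫⁻ x in E k, T N x ^ r ∂μ := by
          refine Finset.sum_le_sum fun k hk => lintegral_mono fun x => ?_
          refine ENNReal.rpow_le_rpow (Finset.sum_le_sum_of_subset ?_) hr0.le
          exact Finset.range_mono (by simpa using hk)
      _ = ∫⁻ x in ⋃ k ∈ Finset.range N, E k, T N x ^ r ∂μ :=
          (lintegral_biUnion_finset (fun i _ j _ hij => hdisj hij) (fun k _ => hE k) _).symm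
      _ ≤ X := setLIntegral_le_lintegral _ _
  have hmain : X ≤ sparseConst r / 2 * Y + X / 2 := by
    calc X ≤ ∫⁻ x, ∑ k ∈ Finset.range N, (sparseConst r / 2 * a k x ^ r +
          4⁻¹ * (S k).indicator (fun x => T (k + 1) x ^ r) x) ∂μ := lintegral_mono (hpt N)
      _ = ∑ k ∈ Finset.range N, (sparseConst r / 2 * ∫⁻ x, a k x ^ r ∂μ +
          4⁻¹ * ∫⁻ x, (S k).indicator (fun x => T (k + 1) x ^ r) x ∂μ) := by
        have hm : ∀ k, Measurable ((S k).indicator (fun x => T (k + 1) x ^ r)) := fun k =>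
          ((hTm _).pow_const r).indicator (hSm k)
        rw [lintegral_finsetSum _ (by
          intro k _
          exact (((ham k).pow_const r).const_mul _).add ((hm k).const_mul _))]
        refine Finset.sum_congr rfl fun k _ => ?_
        rw [lintegral_add_left (((ham k).pow_const r).const_mul _),
          lintegral_const_mul _ ((ham k).pow_const r), lintegral_const_mul _ (hm k)]
      _ ≤ ∑ k ∈ Finset.range N, (sparseConst r / 2 * ∫⁻ x, a k x ^ r ∂μ +
          4⁻¹ * (2 * ∫⁻ x in E k, T (k + 1) x ^ r ∂μ)) := by
        refine Finset.sum_le_sum fun k _ => ?_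
        gcongr
        exact hone k
      _ = sparseConst r / 2 * Y +
          4⁻¹ * (2 * ∑ k ∈ Finset.range N, ∫⁻ x in E k, T (k + 1) x ^ r ∂μ) := by
        rw [Finset.sum_add_distrib, ← Finset.mul_sum, ← Finset.mul_sum, ← Finset.mul_sum]
      _ ≤ sparseConst r / 2 * Y + 4⁻¹ * (2 * X) := by gcongr
      _ = sparseConst r / 2 * Y + X / 2 := by
        congr 1
        rw [← mul_assoc, mul_comm, div_eq_mul_inv]
        congr 1
        rw [show (4 : ℝ≥0∞) = 2 * 2 by norm_num, ENNReal.mul_inv (by simp) (by simp), mul_assoc,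
          ENNReal.inv_mul_cancel (by simp) (by simp), mul_one]
  refine (le_two_mul_of_le_add_half hXtop hmain).trans (le_of_eq ?_)
  rw [← mul_assoc, ENNReal.mul_div_cancel (by simp) (by simp)]

end Sparse

section Carleson

variable {Ω ι : Type*} [MeasurableSpace Ω]

/-- The points whose cell at level `k` is a principal cell for the averages of `H`. -/
def principalSet (A : ℝ≥0∞) (c : ℕ → Ω → ι) (ν H : Measure Ω) (k : ℕ) : Set Ω :=
  {x | IsPrincipal A (fun j => cellAverage c ν H j x) k}

/-- The points whose last principal cell is the one at level `k`. -/
def lastPrincipalSet (A : ℝ≥0∞) (c : ℕ → Ω → ι) (ν H : Measure Ω) (k : ℕ) : Set Ω :=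
  principalSet A c ν H k \ ⋃ j > k, principalSet A c ν H j

theorem principalSet_saturated {A : ℝ≥0∞} {c : ℕ → Ω → ι}
    (hr : ∀ k, (c k).FactorsThrough (c (k + 1))) {ν H : Measure Ω} (k : ℕ) (x y : Ω)
    (hxy : c k x = c k y) (hx : x ∈ principalSet A c ν H k) : y ∈ principalSet A c ν H k :=
  (isPrincipal_congr fun j hj =>
    cellAverage_factorsThrough c ν H j (factorsThrough_of_le hr hj hxy)).1 hx

theorem pairwise_disjoint_lastPrincipalSet (A : ℝ≥0∞) (c : ℕ → Ω → ι) (ν H : Measure Ω) :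
    Pairwise (Function.onFun Disjoint (lastPrincipalSet A c ν H)) := by
  refine (pairwise_disjoint_on _).2 fun j k hjk => Set.disjoint_left.2 fun x hxj hxk => ?_
  exact hxj.2 (mem_iUnion₂.2 ⟨k, hjk, hxk.1⟩)

theorem rpow_cellAverage_mul_le [MeasurableSpace ι] [MeasurableSingletonClass ι]
    {c : ℕ → Ω → ι} {τ : Measure Ω} [IsFiniteMeasure τ] {p : ℝ} (hp : 1 < p)
    {f : Ω → ℝ≥0∞} (hf : Measurable f) (hc : ∀ k, Measurable (c k)) (k : ℕ) (x : Ω) :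
    cellAverage c τ (τ.withDensity f) k x ^ p * τ {y | c k y = c k x} ≤
      τ.withDensity (fun y => f y ^ p) {y | c k y = c k x} := by
  have hQm := measurableSet_cell (hc k) x
  rw [cellAverage]
  set Q : Set Ω := {y | c k y = c k x} with hQ
  have hpq := Real.HolderConjugate.conjExponent hp
  rw [withDensity_apply _ hQm, withDensity_apply _ hQm]
  rcases eq_or_ne (τ Q) 0 with hτ | hτ
  · simp [hτ]
  have hp0 : 0 < p := by linarith
  have hhol : (∫⁻ y in Q, f y ∂τ) ^ p ≤ (∫⁻ y in Q, f y ^ p ∂τ) * τ Q ^ (p - 1) := by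
    have := ENNReal.lintegral_mul_le_Lp_mul_Lq (τ.restrict Q) hpq hf.aemeasurable
      (aemeasurable_const (b := (1 : ℝ≥0∞)))
    simp only [Pi.mul_apply, mul_one, ENNReal.one_rpow, lintegral_const, one_mul,
      Measure.restrict_apply_univ] at this
    refine (ENNReal.rpow_le_rpow this hp0.le).trans (le_of_eq ?_)
    rw [ENNReal.mul_rpow_of_nonneg _ _ hp0.le, ← ENNReal.rpow_mul, ← ENNReal.rpow_mul,
      one_div_mul_cancel hp0.ne', ENNReal.rpow_one]
    congr 2
    rw [Real.conjExponent]
    field_simp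
  have hτ' : τ Q ≠ ∞ := measure_ne_top _ _
  rw [ENNReal.div_rpow_of_nonneg _ _ hp0.le]
  have hτp : τ Q ^ p = τ Q ^ (p - 1) * τ Q := by
    conv_lhs => rw [show p = (p - 1) + 1 by ring, ENNReal.rpow_add _ _ hτ hτ', ENNReal.rpow_one]
  have hne : τ Q ^ p ≠ 0 := (ENNReal.rpow_pos (pos_iff_ne_zero.2 hτ) hτ').ne'
  have hne' : τ Q ^ p ≠ ∞ := ENNReal.rpow_ne_top_of_nonneg hp0.le hτ'
  calc _ ≤ (∫⁻ y in Q, f y ^ p ∂τ) * τ Q ^ (p - 1) / τ Q ^ p * τ Q := by gcongr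
    _ = (∫⁻ y in Q, f y ^ p ∂τ) * (τ Q ^ p * (τ Q ^ p)⁻¹) := by
      rw [div_eq_mul_inv]
      nth_rw 2 [hτp]
      ring
    _ = _ := by rw [ENNReal.mul_inv_cancel hne hne', mul_one]

variable [MeasurableSpace ι] [Countable ι] [MeasurableSingletonClass ι]
  {A : ℝ≥0∞} {c : ℕ → Ω → ι} {ν H μ τ : Measure Ω}

theorem measurableSet_principalSet (hc : ∀ k, Measurable (c k))
    (hr : ∀ k, (c k).FactorsThrough (c (k + 1))) (k : ℕ) :
    MeasurableSet (principalSet A c ν H k) :=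
  measurableSet_of_saturated (hc k) (principalSet_saturated hr k)

theorem measurableSet_lastPrincipalSet (hc : ∀ k, Measurable (c k))
    (hr : ∀ k, (c k).FactorsThrough (c (k + 1))) (k : ℕ) :
    MeasurableSet (lastPrincipalSet A c ν H k) :=
  (measurableSet_principalSet hc hr k).diff
    (MeasurableSet.biUnion (Set.to_countable _) fun j _ => measurableSet_principalSet hc hr j)

theorem measure_cell_diff_lastPrincipalSet_le [IsFiniteMeasure ν] [IsFiniteMeasure H]
    (hA : 1 ≤ A) (hA' : A ≠ ∞) (hc : ∀ k, Measurable (c k))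
    (hr : ∀ k, (c k).FactorsThrough (c (k + 1)))
    {k : ℕ} {x : Ω} (hx : x ∈ principalSet A c ν H k) :
    ν ({y | c k y = c k x} \ lastPrincipalSet A c ν H k) ≤ A⁻¹ * ν {y | c k y = c k x} := by
  set Q : Set Ω := {y | c k y = c k x} with hQ
  set g := cellAverage c ν H k x with hg
  have hA0 : A ≠ 0 := (zero_lt_one.trans_le hA).ne'
  have hsub : Q \ lastPrincipalSet A c ν H k ⊆
      Q ∩ {y | ∃ j, A * g < cellAverage c ν H (k + j) y} := by
    rintro y ⟨hyQ, hy⟩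
    refine ⟨hyQ, ?_⟩
    have hyS : y ∈ principalSet A c ν H k := principalSet_saturated hr k x y hyQ.symm hx
    have hex : ∃ j > k, y ∈ principalSet A c ν H j := by
      by_contra! hcon
      exact hy ⟨hyS, by simpa using hcon⟩
    obtain ⟨j, hj, hyj⟩ := hex
    have hlt := IsPrincipal.mul_lt hA hyS hyj hj
    refine ⟨j - k, ?_⟩
    rw [Nat.add_sub_cancel' hj.le, hg, ← cellAverage_factorsThrough c ν H k hyQ]
    exact hlt
  rcases eq_or_ne (ν Q) 0 with hν | hν
  · rw [hν, mul_zero]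
    exact (measure_mono_null sdiff_subset hν).le
  have hgtop : g ≠ ∞ := ENNReal.div_ne_top (measure_ne_top _ _) hν
  have hgν : g * ν Q = H Q := ENNReal.div_mul_cancel hν (measure_ne_top _ _)
  rcases eq_or_ne g 0 with hg0 | hg0
  · have hHQ : H Q = 0 := by rw [← hgν, hg0, zero_mul]
    have : Q \ lastPrincipalSet A c ν H k = ∅ := by
      refine Set.eq_empty_of_forall_notMem fun y hy => ?_
      obtain ⟨hyQ, j, hj⟩ := hsub hy
      rw [hg0, mul_zero, cellAverage, measure_mono_null (fun z hz => ?_) hHQ,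
        ENNReal.zero_div] at hj
      · exact lt_irrefl _ hj
      · exact (factorsThrough_of_le hr (Nat.le_add_right k j) hz).trans hyQ
    simp [this]
  have hw := mul_measure_exists_lt_cellAverage_le hc hr ν H k (A * g) (Q := Q)
    (fun y z hyz hy => hyz.symm.trans hy)
  have h1 : g * (A * ν (Q \ lastPrincipalSet A c ν H k)) ≤ g * ν Q := by
    rw [hgν, ← mul_assoc, mul_comm g A]
    exact le_trans (by gcongr) hw
  rw [ENNReal.mul_le_mul_iff_right hg0 hgtop] at h1
  calc ν (Q \ lastPrincipalSet A c ν H k)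
      = A⁻¹ * (A * ν (Q \ lastPrincipalSet A c ν H k)) := by
        rw [← mul_assoc, ENNReal.inv_mul_cancel hA0 hA', one_mul]
    _ ≤ _ := by gcongr

/-- Principal cells are sparse for every measure which satisfies an `A_∞` condition with respect
to the base measure. -/
theorem measure_cell_le_two_mul [IsFiniteMeasure ν] [IsFiniteMeasure H] [IsFiniteMeasure μ]
    (hA : 1 ≤ A) (hA' : A ≠ ∞) (hc : ∀ k, Measurable (c k))
    (hr : ∀ k, (c k).FactorsThrough (c (k + 1))) {C : ℝ≥0∞} {δ : ℝ} (hδ : 0 < δ)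
    (hCA : C * A⁻¹ ^ δ ≤ 2⁻¹)
    (hμ : ∀ k x E, MeasurableSet E → E ⊆ {y | c k y = c k x} →
      μ E ≤ C * (ν E / ν {y | c k y = c k x}) ^ δ * μ {y | c k y = c k x})
    (k : ℕ) (x : Ω) (hx : x ∈ principalSet A c ν H k) :
    μ {y | c k y = c k x} ≤ 2 * μ ({y | c k y = c k x} ∩ lastPrincipalSet A c ν H k) := by
  set Q : Set Ω := {y | c k y = c k x} with hQ
  have hE := measurableSet_lastPrincipalSet (A := A) (ν := ν) (H := H) hc hr k
  refine le_two_mul_of_le_add_half (measure_ne_top _ _) ?_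
  calc μ Q = μ (Q ∩ lastPrincipalSet A c ν H k) + μ (Q \ lastPrincipalSet A c ν H k) :=
        (measure_inter_add_sdiff Q hE).symm
    _ ≤ μ (Q ∩ lastPrincipalSet A c ν H k) + C * A⁻¹ ^ δ * μ Q := by
        gcongr
        refine (hμ k x _ ((measurableSet_cell (hc k) x).diff hE) sdiff_subset).trans ?_
        gcongr
        exact ENNReal.div_le_of_le_mul (measure_cell_diff_lastPrincipalSet_le hA hA' hc hr hx)
    _ ≤ μ (Q ∩ lastPrincipalSet A c ν H k) + μ Q / 2 := by
        rw [ENNReal.div_eq_inv_mul]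
        gcongr

/-- Carleson embedding for a sparse family of cells. -/
theorem sum_lintegral_cellAverage_rpow_le [IsFiniteMeasure τ] {p : ℝ} (hp : 1 < p)
    {f : Ω → ℝ≥0∞} (hf : Measurable f) (hc : ∀ k, Measurable (c k))
    (hr : ∀ k, (c k).FactorsThrough (c (k + 1)))
    {S E : ℕ → Set Ω} (hS : ∀ k x y, c k x = c k y → x ∈ S k → y ∈ S k)
    (hE : ∀ k, MeasurableSet (E k)) (hdisj : Pairwise (Function.onFun Disjoint E))
    (hsp : ∀ k, ∀ x ∈ S k, τ {y | c k y = c k x} ≤ 2 * τ ({y | c k y = c k x} ∩ E k)) (N : ℕ) :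
    ∑ k ∈ Finset.range N,
        ∫⁻ x, (S k).indicator (fun x => cellAverage c τ (τ.withDensity f) k x ^ p) x ∂τ ≤
      sparseConst (Real.conjExponent p) ^ (p - 1) * ∫⁻ x, f x ^ p ∂τ := by
  have hp0 : 0 < p := by linarith
  have hpq := Real.HolderConjugate.conjExponent hp
  set p' := Real.conjExponent p with hp'
  have hp'1 : 1 < p' := hpq.symm.lt
  have hp'0 : 0 < p' := by linarith
  set G := ∫⁻ x, f x ^ p ∂τ with hG
  set b : ℕ → Ω → ℝ≥0∞ := cellAverage c τ (τ.withDensity f) with hb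
  have hbf : ∀ k, (b k).FactorsThrough (c k) := cellAverage_factorsThrough c τ _
  set a : ℕ → Ω → ℝ≥0∞ := fun k => (S k).indicator (fun x => b k x ^ (p - 1)) with ha
  have haf : ∀ k, (a k).FactorsThrough (c k) := fun k =>
    indicator_factorsThrough (hS k) fun x y hxy => congrArg (· ^ (p - 1)) (hbf k hxy)
  have ham : ∀ k, Measurable (a k) := fun k => measurable_of_factorsThrough (hc k) (haf k)
  have hap : ∀ k x, (S k).indicator (fun x => b k x ^ p) x = a k x ^ p' := by
    intro k x
    by_cases hx : x ∈ S k
    · simp only [ha, indicator_of_mem hx]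
      rw [← ENNReal.rpow_mul]
      congr 1
      have : p - 1 ≠ 0 := by linarith
      rw [hp', Real.conjExponent]
      field_simp
    · simp [ha, hx, hp'0]
  simp only [hap]
  set Z := ∑ k ∈ Finset.range N, ∫⁻ x, a k x ^ p' ∂τ with hZ
  rcases eq_or_ne G ∞ with hGtop | hGtop
  · rw [hGtop, ENNReal.mul_top]
    · exact le_top
    · exact (ENNReal.rpow_pos (pos_iff_ne_zero.2 (sparseConst_ne_zero hp'0))
        (sparseConst_ne_top hp'0)).ne'
  have hZtop : Z ≠ ∞ := by
    refine (ENNReal.sum_lt_top.2 fun k _ => ?_).ne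
    refine lt_of_le_of_lt ?_ (lt_top_iff_ne_top.2 hGtop)
    have := lintegral_le_of_fiber (hc k) (φ := fun x => a k x ^ p') (ψ := fun _ => 1)
      (fun x y hxy => congrArg (· ^ p') (haf k hxy)) (fun x y hxy => rfl)
      (μ₁ := τ) (μ₂ := τ.withDensity fun y => f y ^ p) (by
        intro x
        rw [one_mul, ← hap]
        by_cases hx : x ∈ S k
        · rw [indicator_of_mem hx]
          exact rpow_cellAverage_mul_le hp hf hc k x
        · simp [hx])
    simpa using this
  have hZle : Z ≤ G ^ (1 / p) * (sparseConst p' * Z) ^ (1 / p') := by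
    calc Z ≤ ∑ k ∈ Finset.range N, ∫⁻ x, a k x ∂(τ.withDensity f) := by
          refine Finset.sum_le_sum fun k _ => ?_
          refine lintegral_le_of_fiber (hc k) (fun x y hxy => congrArg (· ^ p') (haf k hxy))
            (haf k) fun x => ?_
          rw [← hap]
          by_cases hx : x ∈ S k
          · simp only [ha, indicator_of_mem hx]
            rw [show b k x ^ p = b k x ^ (p - 1) * b k x by
              conv_lhs => rw [show p = (p - 1) + 1 by ring,
                ENNReal.rpow_add_of_nonneg _ _ (by linarith) zero_le_one, ENNReal.rpow_one]]
            rw [mul_assoc]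
            gcongr
            rw [mul_comm]
            exact ENNReal.mul_div_le
          · simp [ha, hx]
      _ = ∫⁻ x, (f * fun x => ∑ k ∈ Finset.range N, a k x) x ∂τ := by
          rw [← lintegral_finsetSum _ fun k _ => ham k,
            lintegral_withDensity_eq_lintegral_mul _ hf
              (Finset.measurable_fun_sum _ fun k _ => ham k)]
      _ ≤ G ^ (1 / p) * (∫⁻ x, (∑ k ∈ Finset.range N, a k x) ^ p' ∂τ) ^ (1 / p') :=
          ENNReal.lintegral_mul_le_Lp_mul_Lq τ hpq hf.aemeasurable
            (Finset.measurable_fun_sum _ fun k _ => ham k).aemeasurable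
      _ ≤ _ := by
          gcongr
          exact lintegral_sum_rpow_le_of_sparse hc hr hp'1.le hS hE hdisj hsp haf
            (fun k x hx => indicator_of_notMem hx _) N
  rcases eq_or_ne Z 0 with hZ0 | hZ0
  · rw [hZ0]; exact zero_le
  have hsplit : Z = Z ^ (1 / p) * Z ^ (1 / p') := by
    rw [← ENNReal.rpow_add _ _ hZ0 hZtop]
    simp [hpq.inv_add_inv_eq_one]
  have hroot : Z ^ (1 / p) ≤ G ^ (1 / p) * sparseConst p' ^ (1 / p') := by
    rw [ENNReal.mul_rpow_of_nonneg _ _ (by positivity), ← mul_assoc] at hZle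
    nth_rw 1 [hsplit] at hZle
    rwa [ENNReal.mul_le_mul_iff_left] at hZle
    · exact (ENNReal.rpow_pos (pos_iff_ne_zero.2 hZ0) hZtop).ne'
    · exact ENNReal.rpow_ne_top_of_nonneg (by positivity) hZtop
  have := ENNReal.rpow_le_rpow hroot hp0.le
  rw [ENNReal.mul_rpow_of_nonneg _ _ hp0.le, ← ENNReal.rpow_mul, ← ENNReal.rpow_mul,
    ← ENNReal.rpow_mul, one_div_mul_cancel hp0.ne', ENNReal.rpow_one, ENNReal.rpow_one] at this
  rw [mul_comm]
  convert this using 3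
  rw [hp', Real.conjExponent]
  field_simp


theorem sum_lintegral_rpow_le_mul_rpow [IsFiniteMeasure τ] {p q : ℝ} (hp : 1 < p) (hpq : p ≤ q)
    {f : Ω → ℝ≥0∞} (hc : ∀ k, Measurable (c k)) {K : ℝ≥0∞} {t : ℕ → ℝ≥0∞}
    (hK : ∀ k x, (t k / ν {y | c k y = c k x}) ^ q * μ {y | c k y = c k x} *
      τ {y | c k y = c k x} ^ (q * (1 - 1 / p)) ≤ K)
    {S : ℕ → Set Ω} (hS : ∀ k x y, c k x = c k y → x ∈ S k → y ∈ S k) (N : ℕ) :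
    ∑ k ∈ Finset.range N, ∫⁻ x, (S k).indicator
        (fun x => t k * cellAverage c ν (τ.withDensity f) k x) x ^ q ∂μ ≤
      K * (∑ k ∈ Finset.range N,
        ∫⁻ x, (S k).indicator
          (fun x => cellAverage c τ (τ.withDensity f) k x ^ p) x ∂τ) ^ (q / p) := by
  have hp0 : 0 < p := by linarith
  have hq0 : 0 < q := by linarith
  have hqp : 0 ≤ q / p - 1 := by
    rw [sub_nonneg, le_div_iff₀ hp0]
    linarith
  set b : ℕ → Ω → ℝ≥0∞ := cellAverage c τ (τ.withDensity f) with hb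
  have hbf : ∀ k, (b k).FactorsThrough (c k) := cellAverage_factorsThrough c τ _
  have hbi : ∀ k, ((S k).indicator fun x => b k x ^ p).FactorsThrough (c k) := fun k =>
    indicator_factorsThrough (hS k) fun x y hxy => congrArg (· ^ p) (hbf k hxy)
  set Z := ∑ k ∈ Finset.range N, ∫⁻ x, (S k).indicator (fun x => b k x ^ p) x ∂τ with hZ
  have hbZ : ∀ k ∈ Finset.range N, ∀ x ∈ S k, b k x ^ p * τ {y | c k y = c k x} ≤ Z := by
    intro k hk x hx
    calc b k x ^ p * τ {y | c k y = c k x}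
        = ∫⁻ y in {y | c k y = c k x}, (S k).indicator (fun x => b k x ^ p) y ∂τ := by
          rw [← setLIntegral_const]
          refine setLIntegral_congr_fun (measurableSet_cell (hc k) x) fun y hy => ?_
          rw [hbi k hy, indicator_of_mem hx]
      _ ≤ ∫⁻ y, (S k).indicator (fun x => b k x ^ p) y ∂τ := setLIntegral_le_lintegral _ _
      _ ≤ Z := Finset.single_le_sum
          (f := fun k => ∫⁻ x, (S k).indicator (fun x => b k x ^ p) x ∂τ) (fun _ _ => zero_le) hk
  calc _ ≤ ∑ k ∈ Finset.range N,
        ∫⁻ x, K * Z ^ (q / p - 1) * (S k).indicator (fun x => b k x ^ p) x ∂τ := by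
        refine Finset.sum_le_sum fun k hk => ?_
        refine lintegral_le_of_fiber (hc k) ?_ ?_ fun x => ?_
        · refine fun x y hxy => congrArg (· ^ q) (indicator_factorsThrough (hS k) ?_ hxy)
          exact fun x y hxy => congrArg (t k * ·) (cellAverage_factorsThrough c ν _ k hxy)
        · exact fun x y hxy => congrArg (K * Z ^ (q / p - 1) * ·) (hbi k hxy)
        by_cases hx : x ∈ S k
        swap
        · simp [hx, hq0]
        rw [indicator_of_mem hx, indicator_of_mem hx]
        have hHQ : τ.withDensity f {y | c k y = c k x} = b k x * τ {y | c k y = c k x} := by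
          rcases eq_or_ne (τ {y | c k y = c k x}) 0 with h0 | h0
          · rw [h0, mul_zero]
            exact withDensity_absolutelyContinuous τ f h0
          · exact (ENNReal.div_mul_cancel h0 (measure_ne_top _ _)).symm
        have hZx := hbZ k hk x hx
        have hKx := hK k x
        rw [cellAverage, hHQ]
        set Q : Set Ω := {y | c k y = c k x} with hQ
        set B := b k x with hB
        have hτq : τ Q ^ q = τ Q ^ (q * (1 - 1 / p)) * τ Q ^ (q / p) := by
          have h1 : (1 : ℝ) / p ≤ 1 := by
            rw [div_le_one hp0]
            linarith
          rw [← ENNReal.rpow_add_of_nonneg _ _ (mul_nonneg hq0.le (by linarith)) (by positivity)]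
          congr 1
          ring
        calc (t k * (B * τ Q / ν Q)) ^ q * μ Q
            = ((t k / ν Q) ^ q * μ Q * τ Q ^ (q * (1 - 1 / p))) * (B ^ p * τ Q) ^ (q / p) := by
              rw [show t k * (B * τ Q / ν Q) = (t k / ν Q) * (B * τ Q) by
                simp only [div_eq_mul_inv]; ring]
              rw [ENNReal.mul_rpow_of_nonneg _ _ hq0.le, ENNReal.mul_rpow_of_nonneg _ _ hq0.le,
                hτq, ENNReal.mul_rpow_of_nonneg _ _ (by positivity : 0 ≤ q / p),
                ← ENNReal.rpow_mul, mul_div_cancel₀ _ hp0.ne']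
              ring
          _ ≤ K * (B ^ p * τ Q) ^ (q / p) := by gcongr
          _ = K * ((B ^ p * τ Q) ^ (q / p - 1) * (B ^ p * τ Q)) := by
              conv_lhs => rw [show q / p = (q / p - 1) + 1 by ring,
                ENNReal.rpow_add_of_nonneg _ _ hqp zero_le_one, ENNReal.rpow_one]
          _ ≤ K * (Z ^ (q / p - 1) * (B ^ p * τ Q)) := by gcongr
          _ = _ := by ring
    _ = K * Z ^ (q / p - 1) * Z := by
        rw [hZ, Finset.mul_sum]
        refine Finset.sum_congr rfl fun k _ => ?_
        rw [lintegral_const_mul _ (measurable_of_factorsThrough (hc k) (hbi k))]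
    _ = K * Z ^ (q / p) := by
        conv_rhs => rw [show q / p = (q / p - 1) + 1 by ring,
          ENNReal.rpow_add_of_nonneg _ _ hqp zero_le_one, ENNReal.rpow_one]
        ring

/-- The constant in the two-weight inequality for dyadic potentials. -/
def potentialConst (p q : ℝ) (A K : ℝ≥0∞) : ℝ≥0∞ :=
  (2 * A) ^ q * (sparseConst q * (K * (sparseConst (Real.conjExponent p) ^ (p - 1)) ^ (q / p)))

theorem potentialConst_ne_top {p q : ℝ} (hp : 1 < p) (hpq : p ≤ q) {A K : ℝ≥0∞} (hA : A ≠ ∞)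
    (hK : K ≠ ∞) : potentialConst p q A K ≠ ∞ := by
  have hp' := (Real.HolderConjugate.conjExponent hp).symm.pos
  have h1 := sparseConst_ne_top (show 0 < q by linarith)
  have h2 := sparseConst_ne_top hp'
  have h3 : 0 ≤ p - 1 := by linarith
  have h4 : 0 ≤ q / p := div_nonneg (by linarith) (by linarith)
  refine ENNReal.mul_ne_top (ENNReal.rpow_ne_top_of_nonneg (by linarith)
    (ENNReal.mul_ne_top (by simp) hA)) (ENNReal.mul_ne_top h1 (ENNReal.mul_ne_top hK ?_))
  exact ENNReal.rpow_ne_top_of_nonneg h4 (ENNReal.rpow_ne_top_of_nonneg h3 h2)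

/-- Two-weight inequality for dyadic potentials under `A_∞` conditions. -/
theorem lintegral_tsum_mul_cellAverage_rpow_le [IsFiniteMeasure ν] [IsFiniteMeasure μ]
    [IsFiniteMeasure τ] {p q : ℝ} (hp : 1 < p) (hpq : p ≤ q) (hA : 1 ≤ A) (hA' : A ≠ ∞)
    (hc : ∀ k, Measurable (c k)) (hr : ∀ k, (c k).FactorsThrough (c (k + 1)))
    {C₁ C₂ : ℝ≥0∞} {δ₁ δ₂ : ℝ} (hδ₁ : 0 < δ₁) (hδ₂ : 0 < δ₂)
    (hCA₁ : C₁ * A⁻¹ ^ δ₁ ≤ 2⁻¹) (hCA₂ : C₂ * A⁻¹ ^ δ₂ ≤ 2⁻¹)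
    (hμ : ∀ k x E, MeasurableSet E → E ⊆ {y | c k y = c k x} →
      μ E ≤ C₁ * (ν E / ν {y | c k y = c k x}) ^ δ₁ * μ {y | c k y = c k x})
    (hτ : ∀ k x E, MeasurableSet E → E ⊆ {y | c k y = c k x} →
      τ E ≤ C₂ * (ν E / ν {y | c k y = c k x}) ^ δ₂ * τ {y | c k y = c k x})
    {K : ℝ≥0∞} {t : ℕ → ℝ≥0∞} (ht : ∀ k, 2 * t (k + 1) = t k)
    (hK : ∀ k x, (t k / ν {y | c k y = c k x}) ^ q * μ {y | c k y = c k x} *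
      τ {y | c k y = c k x} ^ (q * (1 - 1 / p)) ≤ K)
    {f : Ω → ℝ≥0∞} (hf : Measurable f) (hfi : ∫⁻ x, f x ∂τ ≠ ∞) :
    ∫⁻ x, (∑' k, t k * cellAverage c ν (τ.withDensity f) k x) ^ q ∂μ ≤
      potentialConst p q A K * (∫⁻ x, f x ^ p ∂τ) ^ (q / p) := by
  have hq0 : 0 < q := by linarith
  have hqp0 : 0 ≤ q / p := div_nonneg (by linarith) (by linarith)
  set H := τ.withDensity f with hH
  have : IsFiniteMeasure H := isFiniteMeasure_withDensity hfi
  set h : ℕ → Ω → ℝ≥0∞ := cellAverage c ν H with hh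
  have hhf : ∀ k, (fun x => t k * h k x).FactorsThrough (c k) := fun k x y hxy =>
    congrArg (t k * ·) (cellAverage_factorsThrough c ν H k hxy)
  set S := principalSet A c ν H with hS
  have hSsat : ∀ k x y, c k x = c k y → x ∈ S k → y ∈ S k := principalSet_saturated hr
  have hEm : ∀ k, MeasurableSet (lastPrincipalSet A c ν H k) :=
    measurableSet_lastPrincipalSet hc hr
  have hdisj := pairwise_disjoint_lastPrincipalSet A c ν H
  have hm : ∀ N, Measurable fun x => ∑ k ∈ Finset.range N, t k * h k x := fun N =>
    Finset.measurable_fun_sum _ fun k _ => measurable_of_factorsThrough (hc k) (hhf k)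
  have hfin : ∀ N, ∫⁻ x, (∑ k ∈ Finset.range N, t k * h k x) ^ q ∂μ ≤
      potentialConst p q A K * (∫⁻ x, f x ^ p ∂τ) ^ (q / p) := by
    intro N
    calc _ ≤ ∫⁻ x, (2 * A) ^ q *
          (∑ k ∈ Finset.range N, (S k).indicator (fun x => t k * h k x) x) ^ q ∂μ := by
          refine lintegral_mono fun x => ?_
          simp only
          rw [← ENNReal.mul_rpow_of_nonneg _ _ hq0.le]
          refine ENNReal.rpow_le_rpow ?_ hq0.le
          classical
          refine (sum_mul_le_sum_isPrincipal hA ht N (g := fun j => h j x)).trans (le_of_eq ?_)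
          congr 1
      _ = (2 * A) ^ q * ∫⁻ x,
          (∑ k ∈ Finset.range N, (S k).indicator (fun x => t k * h k x) x) ^ q ∂μ := by
          refine lintegral_const_mul _ (Measurable.pow_const ?_ q)
          exact Finset.measurable_fun_sum _ fun k _ =>
            measurable_of_factorsThrough (hc k) (indicator_factorsThrough (hSsat k) (hhf k))
      _ ≤ (2 * A) ^ q * (sparseConst q * ∑ k ∈ Finset.range N,
          ∫⁻ x, (S k).indicator (fun x => t k * h k x) x ^ q ∂μ) := by
          gcongr
          exact lintegral_sum_rpow_le_of_sparse hc hr (by linarith) hSsat hEm hdisj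
            (measure_cell_le_two_mul hA hA' hc hr hδ₁ hCA₁ hμ)
            (fun k => indicator_factorsThrough (hSsat k) (hhf k))
            (fun k x hx => indicator_of_notMem hx _) N
      _ ≤ (2 * A) ^ q * (sparseConst q * (K * (sparseConst (Real.conjExponent p) ^ (p - 1) *
          ∫⁻ x, f x ^ p ∂τ) ^ (q / p))) := by
          gcongr
          refine (sum_lintegral_rpow_le_mul_rpow hp hpq hc hK hSsat N).trans ?_
          gcongr
          exact sum_lintegral_cellAverage_rpow_le hp hf hc hr hSsat hEm hdisj
            (measure_cell_le_two_mul hA hA' hc hr hδ₂ hCA₂ hτ) N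
      _ = _ := by
          rw [potentialConst, ENNReal.mul_rpow_of_nonneg _ _ hqp0]
          ring
  have hsup : ∀ x, (∑' k, t k * h k x) ^ q =
      ⨆ N, (∑ k ∈ Finset.range N, t k * h k x) ^ q := by
    intro x
    rw [ENNReal.tsum_eq_iSup_nat]
    exact (ENNReal.orderIsoRpow q hq0).map_iSup _
  simp only [hsup]
  rw [lintegral_iSup (fun N => (hm N).pow_const q)]
  · exact iSup_le hfin
  · intro M N hMN x
    exact ENNReal.rpow_le_rpow (Finset.sum_le_sum_of_subset (Finset.range_mono hMN)) hq0.le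

end Carleson

section Poincare

variable {E : Type*} [NormedAddCommGroup E] [NormedSpace ℝ E]

open Classical in
/-- The norm of the derivative of an `L`-Lipschitz function, set to `L` at the points of
non-differentiability. -/
def lipSlope (u : E → ℝ) (L : ℝ≥0) (z : E) : ℝ≥0∞ :=
  if DifferentiableAt ℝ u z then ‖fderiv ℝ u z‖ₑ else L

theorem enorm_sub_le_lintegral_lipSlope {u : E → ℝ} {L : ℝ≥0} (hu : LipschitzWith L u) (x y : E) :
    ‖u y - u x‖ₑ ≤ ‖y - x‖ₑ * ∫⁻ t in Ioc (0 : ℝ) 1, lipSlope u L (AffineMap.lineMap x y t) := by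
  set g : ℝ → ℝ := fun t => u (AffineMap.lineMap x y t) with hg
  have hlip : LipschitzWith (L * ‖y - x‖₊) g := by
    refine LipschitzWith.of_dist_le_mul fun s t => (hu.dist_le_mul _ _).trans (le_of_eq ?_)
    rw [dist_lineMap_lineMap, NNReal.coe_mul, coe_nnnorm, ← dist_eq_norm', mul_assoc,
      mul_comm (dist s t)]
  have hftc : ∫ t in (0 : ℝ)..1, deriv g t = u y - u x := by
    have habs := (hlip.lipschitzOnWith (s := uIcc 0 1)).absolutelyContinuousOnInterval
    rw [habs.integral_deriv_eq_sub]
    simp [hg]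
  have hderiv : ∀ t, ‖deriv g t‖ₑ ≤ ‖y - x‖ₑ * lipSlope u L (AffineMap.lineMap x y t) := by
    intro t
    rw [lipSlope]
    split_ifs with hd
    · have h1 : HasDerivAt g (fderiv ℝ u (AffineMap.lineMap x y t) (y - x)) t :=
        hd.hasFDerivAt.comp_hasDerivAt t AffineMap.hasDerivAt_lineMap
      rw [h1.deriv, mul_comm]
      exact ContinuousLinearMap.le_opENorm _ _
    · have := norm_deriv_le_of_lipschitz hlip (x₀ := t)
      rw [mul_comm]
      rw [enorm_eq_nnnorm, enorm_eq_nnnorm]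
      exact_mod_cast this
  rw [← hftc, intervalIntegral.integral_of_le zero_le_one]
  refine (enorm_integral_le_lintegral_enorm _).trans ?_
  rw [← lintegral_const_mul' _ _ enorm_ne_top]
  exact lintegral_mono hderiv

variable [MeasurableSpace E] [BorelSpace E]

theorem measurable_lipSlope (u : E → ℝ) (L : ℝ≥0) [FiniteDimensional ℝ E] :
    Measurable (lipSlope u L) :=
  Measurable.ite (measurableSet_of_differentiableAt ℝ u) (measurable_fderiv ℝ u).enorm
    measurable_const

variable [FiniteDimensional ℝ E] {μ : Measure E} [μ.IsAddHaarMeasure]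

theorem lipSlope_ae_eq {u : E → ℝ} {L : ℝ≥0} (hu : LipschitzWith L u) :
    lipSlope u L =ᵐ[μ] fun z => ‖fderiv ℝ u z‖ₑ := by
  filter_upwards [hu.ae_differentiableAt (μ := μ)] with z hz
  rw [lipSlope, if_pos hz]

theorem setLIntegral_comp_smul_add_le {F : E → ℝ≥0∞} (hF : Measurable F) {Q : Set E}
    (hQ : MeasurableSet Q) {r : ℝ} (hr : 1 / 2 ≤ r) (b : E) (hb : ∀ y ∈ Q, r • y + b ∈ Q) :
    ∫⁻ y in Q, F (r • y + b) ∂μ ≤ 2 ^ Module.finrank ℝ E * ∫⁻ z in Q, F z ∂μ := by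
  have hr0 : 0 < r := by linarith
  have hFi : Measurable (Q.indicator F) := hF.indicator hQ
  calc ∫⁻ y in Q, F (r • y + b) ∂μ
      ≤ ∫⁻ y, Q.indicator F (r • y + b) ∂μ := by
        rw [← lintegral_indicator hQ]
        refine lintegral_mono fun y => ?_
        by_cases hy : y ∈ Q
        · simp [hy, hb y hy]
        · simp [hy]
    _ = ∫⁻ z, Q.indicator F (z + b) ∂(Measure.map (r • ·) μ) := by
        rw [lintegral_map (f := fun z => Q.indicator F (z + b))
          (hFi.comp (measurable_add_const b)) (measurable_const_smul r)]
    _ = ENNReal.ofReal |(r ^ Module.finrank ℝ E)⁻¹| * ∫⁻ z, Q.indicator F z ∂μ := by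
        rw [Measure.map_addHaar_smul μ hr0.ne', lintegral_smul_measure,
          lintegral_add_right_eq_self (Q.indicator F) b, smul_eq_mul]
    _ ≤ 2 ^ Module.finrank ℝ E * ∫⁻ z in Q, F z ∂μ := by
        rw [lintegral_indicator hQ]
        gcongr
        rw [abs_of_nonneg (by positivity), ← inv_pow, ENNReal.ofReal_pow (by positivity)]
        gcongr
        rw [← ENNReal.ofReal_ofNat]
        refine ENNReal.ofReal_le_ofReal ?_
        rw [inv_le_comm₀ hr0 (by norm_num)]
        linarith

theorem measurable_comp_lineMap {F : E → ℝ≥0∞} (hF : Measurable F) :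
    Measurable fun z : (E × E) × ℝ => F (AffineMap.lineMap z.1.1 z.1.2 z.2) := by
  refine hF.comp (Continuous.measurable ?_)
  simp only [AffineMap.lineMap_apply_module]
  fun_prop

theorem lintegral_lintegral_comp_lineMap_le {F : E → ℝ≥0∞} (hF : Measurable F) {Q : Set E}
    (hQ : MeasurableSet Q) (hconv : Convex ℝ Q) {t : ℝ} (ht : t ∈ Ioc (0 : ℝ) 1) :
    ∫⁻ x in Q, ∫⁻ y in Q, F (AffineMap.lineMap x y t) ∂μ ∂μ ≤
      2 ^ Module.finrank ℝ E * (∫⁻ z in Q, F z ∂μ) * μ Q := by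
  rw [← setLIntegral_const]
  rcases le_total (1 / 2) t with h | h
  · refine setLIntegral_mono' hQ fun x hx => ?_
    have hxy : ∀ y, AffineMap.lineMap x y t = t • y + (1 - t) • x := fun y => by
      rw [AffineMap.lineMap_apply_module, add_comm]
    simp only [hxy]
    refine setLIntegral_comp_smul_add_le hF hQ h _ fun y hy => ?_
    exact hconv hy hx ht.1.le (by linarith [ht.2]) (by ring)
  · have hm : Measurable fun z : E × E => F (AffineMap.lineMap z.1 z.2 t) :=
      (measurable_comp_lineMap hF).comp (measurable_id.prodMk measurable_const)
    rw [lintegral_lintegral_swap hm.aemeasurable]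
    refine setLIntegral_mono' hQ fun y hy => ?_
    simp only [AffineMap.lineMap_apply_module]
    refine setLIntegral_comp_smul_add_le hF hQ (by linarith) _ fun x hx => ?_
    exact hconv hx hy (by linarith) ht.1.le (by ring)

theorem lintegral_prod_lineMap_le {F : E → ℝ≥0∞} (hF : Measurable F) {Q : Set E}
    (hQ : MeasurableSet Q) (hconv : Convex ℝ Q) :
    ∫⁻ z, (∫⁻ t in Ioc (0 : ℝ) 1, F (AffineMap.lineMap z.1 z.2 t))
        ∂((μ.restrict Q).prod (μ.restrict Q)) ≤
      2 ^ Module.finrank ℝ E * (∫⁻ z in Q, F z ∂μ) * μ Q := by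
  rw [lintegral_lintegral_swap (measurable_comp_lineMap hF).aemeasurable]
  have hlevel : ∀ t ∈ Ioc (0 : ℝ) 1,
      ∫⁻ z, F (AffineMap.lineMap z.1 z.2 t) ∂((μ.restrict Q).prod (μ.restrict Q)) ≤
        2 ^ Module.finrank ℝ E * (∫⁻ z in Q, F z ∂μ) * μ Q := by
    intro t ht
    have hm : Measurable fun z : E × E => F (AffineMap.lineMap z.1 z.2 t) :=
      (measurable_comp_lineMap hF).comp (measurable_id.prodMk measurable_const)
    rw [lintegral_prod _ hm.aemeasurable]
    exact lintegral_lintegral_comp_lineMap_le hF hQ hconv ht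
  refine (setLIntegral_mono' measurableSet_Ioc hlevel).trans (le_of_eq ?_)
  rw [setLIntegral_const, Real.volume_Ioc, sub_zero, ENNReal.ofReal_one, mul_one]

/-- Poincaré inequality on a bounded convex set, in double-integral form. -/
theorem lintegral_lintegral_enorm_sub_le {u : E → ℝ} {L : ℝ≥0} (hu : LipschitzWith L u)
    {Q : Set E} (hQ : MeasurableSet Q) (hconv : Convex ℝ Q) {d : ℝ≥0∞}
    (hd : ∀ x ∈ Q, ∀ y ∈ Q, ‖y - x‖ₑ ≤ d) :
    ∫⁻ x in Q, ∫⁻ y in Q, ‖u y - u x‖ₑ ∂μ ∂μ ≤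
      d * (2 ^ Module.finrank ℝ E * (∫⁻ z in Q, ‖fderiv ℝ u z‖ₑ ∂μ) * μ Q) := by
  have hFint : ∫⁻ z in Q, lipSlope u L z ∂μ = ∫⁻ z in Q, ‖fderiv ℝ u z‖ₑ ∂μ :=
    lintegral_congr_ae (ae_restrict_of_ae (lipSlope_ae_eq hu))
  have hF : Measurable (lipSlope u L) := measurable_lipSlope u L
  rw [← hFint]
  generalize hG : (fun z : E × E =>
    ∫⁻ t in Ioc (0 : ℝ) 1, lipSlope u L (AffineMap.lineMap z.1 z.2 t)) = G
  have hGm : Measurable G := hG ▸ (measurable_comp_lineMap hF).lintegral_prod_right'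
  have hle : ∀ x y, ‖u y - u x‖ₑ ≤ ‖y - x‖ₑ * G (x, y) := by
    subst hG
    exact enorm_sub_le_lintegral_lipSlope hu
  have hGi : ∫⁻ z, G z ∂((μ.restrict Q).prod (μ.restrict Q)) ≤
      2 ^ Module.finrank ℝ E * (∫⁻ z in Q, lipSlope u L z ∂μ) * μ Q := by
    subst hG
    exact lintegral_prod_lineMap_le hF hQ hconv
  calc ∫⁻ x in Q, ∫⁻ y in Q, ‖u y - u x‖ₑ ∂μ ∂μ
      ≤ ∫⁻ x in Q, ∫⁻ y in Q, d * G (x, y) ∂μ ∂μ := by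
        refine setLIntegral_mono' hQ fun x hx => setLIntegral_mono' hQ fun y hy => ?_
        exact (hle x y).trans (mul_le_mul_left (hd x hx y hy) _)
    _ = d * ∫⁻ z, G z ∂((μ.restrict Q).prod (μ.restrict Q)) := by
        rw [← lintegral_const_mul _ hGm, lintegral_prod _ (hGm.const_mul d).aemeasurable]
    _ ≤ _ := by gcongr

end Poincare

section Dyadic

variable {n : ℕ}

theorem cube_eq_preimage (a : Rn n) (l : ℝ) :
    Cube a l = WithLp.ofLp ⁻¹' (univ.pi fun i => Ico (a i) (a i + l)) := by
  ext x
  simp [Cube]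

theorem measurableSet_cube (a : Rn n) (l : ℝ) : MeasurableSet (Cube a l) := by
  rw [cube_eq_preimage]
  exact (PiLp.volume_preserving_ofLp (Fin n)).measurable
    (MeasurableSet.univ_pi fun i => measurableSet_Ico)

theorem convex_cube (a : Rn n) (l : ℝ) : Convex ℝ (Cube a l) := by
  intro x hx y hy s t hs ht hst i
  have := convex_Ico (a i) (a i + l) (hx i) (hy i) hs ht hst
  simpa using this

theorem volume_cube (a : Rn n) (l : ℝ) : volume (Cube a l) = ENNReal.ofReal l ^ n := by
  rw [cube_eq_preimage, (PiLp.volume_preserving_ofLp (Fin n)).measure_preimage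
    (MeasurableSet.univ_pi fun i => measurableSet_Ico).nullMeasurableSet, Real.volume_pi_Ico]
  simp

theorem enorm_sub_le_of_mem_cube {a : Rn n} {l : ℝ} {x y : Rn n} (hx : x ∈ Cube a l)
    (hy : y ∈ Cube a l) : ‖y - x‖ₑ ≤ n * ENNReal.ofReal l := by
  have h : ‖y - x‖ ≤ n * l := by
    rw [EuclideanSpace.norm_eq]
    refine Real.sqrt_le_iff.2 ?_
    rcases Nat.eq_zero_or_pos n with rfl | hn
    · simp
    have hl : 0 ≤ l := by have := hx ⟨0, hn⟩; linarith
    refine ⟨by positivity, ?_⟩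
    calc ∑ i, ‖(y - x) i‖ ^ 2 ≤ ∑ _i : Fin n, l ^ 2 := by
          refine Finset.sum_le_sum fun i _ => ?_
          have h1 := hx i
          have h2 := hy i
          have : ‖(y - x) i‖ ≤ l := by
            rw [PiLp.sub_apply, Real.norm_eq_abs, abs_le]
            constructor <;> linarith
          gcongr
      _ = n * l ^ 2 := by simp
      _ ≤ (n * l) ^ 2 := by
          rw [mul_pow]
          gcongr
          exact_mod_cast Nat.le_self_pow two_ne_zero n
  rw [← ofReal_norm]
  refine (ENNReal.ofReal_le_ofReal h).trans (le_of_eq ?_)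
  rw [ENNReal.ofReal_mul (by positivity), ENNReal.ofReal_natCast]

/-- The index of the dyadic cube of generation `k` relative to `Cube a l` that contains `x`. -/
def dyadicIndex (a : Rn n) (l : ℝ) (k : ℕ) (x : Rn n) : Fin n → ℤ :=
  fun i => ⌊2 ^ k * ((x i - a i) / l)⌋

theorem measurable_dyadicIndex (a : Rn n) (l : ℝ) (k : ℕ) :
    Measurable (dyadicIndex a l k) := by
  refine measurable_pi_lambda _ fun i => Int.measurable_floor.comp ?_
  have : Measurable fun x : Rn n => x i :=
    (measurable_pi_apply i).comp (PiLp.volume_preserving_ofLp (Fin n)).measurable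
  fun_prop

theorem floor_eq_floor_two_mul_div (z : ℝ) : ⌊z⌋ = ⌊2 * z⌋ / 2 := by
  rw [Int.floor_eq_iff]
  have h1 := Int.floor_le (2 * z)
  have h2 := Int.lt_floor_add_one (2 * z)
  have h3 : 2 * (⌊2 * z⌋ / 2) ≤ ⌊2 * z⌋ := by omega
  have h4 : ⌊2 * z⌋ + 1 ≤ 2 * (⌊2 * z⌋ / 2) + 2 := by omega
  have h3' : 2 * ((⌊2 * z⌋ / 2 : ℤ) : ℝ) ≤ ⌊2 * z⌋ := by exact_mod_cast h3
  have h4' : (⌊2 * z⌋ : ℝ) + 1 ≤ 2 * ((⌊2 * z⌋ / 2 : ℤ) : ℝ) + 2 := by exact_mod_cast h4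
  constructor <;> linarith

theorem dyadicIndex_eq_div (a : Rn n) (l : ℝ) (k : ℕ) (x : Rn n) (i : Fin n) :
    dyadicIndex a l k x i = dyadicIndex a l (k + 1) x i / 2 := by
  rw [dyadicIndex, floor_eq_floor_two_mul_div, dyadicIndex, pow_succ']
  ring_nf

theorem dyadicIndex_factorsThrough (a : Rn n) (l : ℝ) (k : ℕ) :
    (dyadicIndex a l k).FactorsThrough (dyadicIndex a l (k + 1)) := by
  intro x y hxy
  ext i
  rw [dyadicIndex_eq_div a l k x, dyadicIndex_eq_div a l k y, hxy]

theorem dyadicCell_eq (a : Rn n) {l : ℝ} (hl : 0 < l) (k : ℕ) (x : Rn n) :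
    {y | dyadicIndex a l k y = dyadicIndex a l k x} =
      {y : Rn n | ∀ i, a i + l * (dyadicIndex a l k x i) / 2 ^ k ≤ y i ∧
        y i < a i + l * (dyadicIndex a l k x i) / 2 ^ k + l / 2 ^ k} := by
  ext y
  have h2 : (0 : ℝ) < 2 ^ k := by positivity
  simp only [mem_ofPred_eq, funext_iff]
  refine forall_congr' fun i => ?_
  generalize dyadicIndex a l k x i = m
  rw [dyadicIndex, Int.floor_eq_iff]
  have e : 2 ^ k * ((y i - a i) / l) = (y i - a i) / (l / 2 ^ k) := by field_simp
  have hs : 0 < l / 2 ^ k := by positivity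
  have e' : l * m / 2 ^ k = m * (l / 2 ^ k) := by ring
  rw [e, e', le_div_iff₀ hs, div_lt_iff₀ hs, add_mul, one_mul]
  constructor <;> rintro ⟨h, h'⟩ <;> constructor <;> linarith

theorem dyadicCell_eq_cube (a : Rn n) {l : ℝ} (hl : 0 < l) (k : ℕ) (x : Rn n) :
    ∃ b : Rn n, {y | dyadicIndex a l k y = dyadicIndex a l k x} = Cube b (l / 2 ^ k) :=
  ⟨WithLp.toLp 2 fun i => a i + l * (dyadicIndex a l k x i) / 2 ^ k, dyadicCell_eq a hl k x⟩

theorem mem_cube_iff_dyadicIndex (a : Rn n) {l : ℝ} (hl : 0 < l) (x : Rn n) :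
    x ∈ Cube a l ↔ dyadicIndex a l 0 x = 0 := by
  simp only [Cube, mem_ofPred_eq, funext_iff]
  refine forall_congr' fun i => ?_
  rw [dyadicIndex, Pi.zero_apply, Int.floor_eq_iff, pow_zero, one_mul, Int.cast_zero, zero_add,
    le_div_iff₀ hl, div_lt_iff₀ hl]
  constructor <;> rintro ⟨h, h'⟩ <;> constructor <;> linarith

theorem dyadicIndex_zero_eq {a : Rn n} {l : ℝ} {k : ℕ} {x y : Rn n}
    (h : dyadicIndex a l k y = dyadicIndex a l k x) :
    dyadicIndex a l 0 y = dyadicIndex a l 0 x := by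
  induction k with
  | zero => exact h
  | succ k ih => exact ih (dyadicIndex_factorsThrough a l k h)

theorem dyadicCell_zero {a : Rn n} {l : ℝ} (hl : 0 < l) {x : Rn n} (hx : x ∈ Cube a l) :
    {y | dyadicIndex a l 0 y = dyadicIndex a l 0 x} = Cube a l := by
  ext y
  rw [mem_cube_iff_dyadicIndex a hl] at hx ⊢
  rw [mem_ofPred_eq, hx]

theorem dyadicCell_subset {a : Rn n} {l : ℝ} (hl : 0 < l) {x : Rn n} (hx : x ∈ Cube a l)
    (k : ℕ) : {y | dyadicIndex a l k y = dyadicIndex a l k x} ⊆ Cube a l := by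
  rw [← dyadicCell_zero hl hx]
  exact fun y hy => dyadicIndex_zero_eq hy

theorem dyadicCell_disjoint {a : Rn n} {l : ℝ} (hl : 0 < l) {x : Rn n} (hx : x ∉ Cube a l)
    (k : ℕ) : {y | dyadicIndex a l k y = dyadicIndex a l k x} ∩ Cube a l = ∅ := by
  refine eq_empty_of_forall_notMem fun y hy => hx ?_
  rw [mem_cube_iff_dyadicIndex a hl, ← dyadicIndex_zero_eq hy.1]
  exact (mem_cube_iff_dyadicIndex a hl y).1 hy.2

theorem isDyadicSub_dyadicCell {a : Rn n} {l : ℝ} (hl : 0 < l) {x : Rn n} (hx : x ∈ Cube a l)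
    (k : ℕ) : IsDyadicSub a l {y | dyadicIndex a l k y = dyadicIndex a l k x} := by
  have h2 : (0 : ℝ) < 2 ^ k := by positivity
  have h0 : ∀ i, 0 ≤ dyadicIndex a l k x i := fun i => by
    refine Int.floor_nonneg.2 (mul_nonneg h2.le (div_nonneg ?_ hl.le))
    linarith [(hx i).1]
  refine ⟨k, fun i => (dyadicIndex a l k x i).toNat, fun i => ?_, ?_⟩
  · have : dyadicIndex a l k x i < 2 ^ k := by
      rw [dyadicIndex, Int.floor_lt]
      push_cast
      refine mul_lt_of_lt_one_right h2 ((div_lt_one hl).2 ?_)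
      linarith [(hx i).2]
    zify
    rwa [Int.toNat_of_nonneg (h0 i)]
  · rw [dyadicCell_eq a hl]
    have : ∀ i, (((dyadicIndex a l k x i).toNat : ℕ) : ℝ) = (dyadicIndex a l k x i : ℝ) :=
      fun i => by exact_mod_cast Int.toNat_of_nonneg (h0 i)
    simp only [this]

end Dyadic

section Telescoping

open Filter Topology

theorem enorm_setAverage_sub_le {Ω : Type*} [MeasurableSpace Ω] {μ : Measure Ω} {Q : Set Ω}
    (h0 : μ Q ≠ 0) (ht : μ Q ≠ ∞) {u : Ω → ℝ} (hu : IntegrableOn u Q μ) (c : ℝ) :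
    ‖(⨍ y in Q, u y ∂μ) - c‖ₑ ≤ (μ Q)⁻¹ * ∫⁻ y in Q, ‖u y - c‖ₑ ∂μ := by
  have hpos : 0 < μ.real Q := ENNReal.toReal_pos h0 ht
  have hc : IntegrableOn (fun _ => c) Q μ := integrableOn_const ht
  have : (⨍ y in Q, u y ∂μ) - c = (μ.real Q)⁻¹ * ∫ y in Q, (u y - c) ∂μ := by
    rw [setAverage_eq, integral_sub hu hc, setIntegral_const, smul_eq_mul, smul_eq_mul]
    field_simp
  rw [this, enorm_mul]
  gcongr
  · rw [Real.enorm_of_nonneg (by positivity), ENNReal.ofReal_inv_of_pos hpos, measureReal_def,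
      ENNReal.ofReal_toReal ht]
  · exact enorm_integral_le_lintegral_enorm _

theorem enorm_setAverage_sub_setAverage_le {Ω : Type*} [MeasurableSpace Ω] {μ : Measure Ω}
    {S Q : Set Ω} (hSQ : S ⊆ Q) (h0 : μ S ≠ 0) (ht : μ Q ≠ ∞) {u : Ω → ℝ}
    (hu : IntegrableOn u Q μ) :
    ‖(⨍ y in S, u y ∂μ) - ⨍ y in Q, u y ∂μ‖ₑ ≤
      (μ S)⁻¹ * ((μ Q)⁻¹ * ∫⁻ x in Q, ∫⁻ y in Q, ‖u y - u x‖ₑ ∂μ ∂μ) := by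
  have htS : μ S ≠ ∞ := measure_ne_top_of_subset hSQ ht
  have h0Q : μ Q ≠ 0 := fun h => h0 (measure_mono_null hSQ h)
  refine (enorm_setAverage_sub_le h0 htS (hu.mono_set hSQ) _).trans ?_
  gcongr
  rw [← lintegral_const_mul' _ _ (ENNReal.inv_ne_top.2 h0Q)]
  refine (lintegral_mono_set hSQ).trans (lintegral_mono fun x => ?_)
  rw [← enorm_neg, neg_sub]
  exact enorm_setAverage_sub_le h0Q ht hu _

variable {n : ℕ}

theorem integrableOn_cube_of_lipschitzWith {u : Rn n → ℝ} {L : ℝ≥0} (hu : LipschitzWith L u)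
    (b : Rn n) (s : ℝ) : IntegrableOn u (Cube b s) := by
  have hb : Bornology.IsBounded (Cube b s) := by
    refine Metric.isBounded_iff_ediam_ne_top.2
      (ne_top_of_le_ne_top (b := n * ENNReal.ofReal s) ?_ ?_)
    · finiteness
    · refine Metric.ediam_le fun x hx y hy => ?_
      rw [edist_eq_enorm_sub]
      exact enorm_sub_le_of_mem_cube hy hx
  exact (hu.continuous.continuousOn.integrableOn_compact hb.isCompact_closure).mono_set
    subset_closure

/-- A Lipschitz function is controlled by the sum over the dyadic generations of the scaled
averages of its gradient. -/
theorem enorm_sub_setAverage_le_tsum {a : Rn n} {l : ℝ} (hl : 0 < l) {u : Rn n → ℝ} {L : ℝ≥0}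
    (hu : LipschitzWith L u) {x : Rn n} (hx : x ∈ Cube a l) :
    ‖u x - ⨍ y in Cube a l, u y‖ₑ ≤ 4 ^ n * n * ∑' k, ENNReal.ofReal (l / 2 ^ k) *
      ((∫⁻ y in {y | dyadicIndex a l k y = dyadicIndex a l k x}, ‖fderiv ℝ u y‖ₑ) /
        volume {y | dyadicIndex a l k y = dyadicIndex a l k x}) := by
  set Q : ℕ → Set (Rn n) := fun k => {y | dyadicIndex a l k y = dyadicIndex a l k x} with hQ
  choose b hb using fun k => dyadicCell_eq_cube a hl k x
  have hb' : ∀ k, Q k = Cube (b k) (l / 2 ^ k) := hb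
  have hs : ∀ k : ℕ, 0 < l / 2 ^ k := fun k => by positivity
  have hvol : ∀ k, volume (Q k) = ENNReal.ofReal (l / 2 ^ k) ^ n := fun k => by
    rw [hb', volume_cube]
  have h0 : ∀ k, volume (Q k) ≠ 0 := fun k => by
    rw [hvol]
    exact pow_ne_zero _ (ENNReal.ofReal_pos.2 (hs k)).ne'
  have ht : ∀ k, volume (Q k) ≠ ∞ := fun k => by
    rw [hvol]
    finiteness
  have hui : ∀ k, IntegrableOn u (Q k) := fun k => by
    rw [hb']
    exact integrableOn_cube_of_lipschitzWith hu _ _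
  have hsub : ∀ k, Q (k + 1) ⊆ Q k := fun k y hy => dyadicIndex_factorsThrough a l k hy
  have hdiam : ∀ k, ∀ y ∈ Q k, ∀ z ∈ Q k, ‖z - y‖ₑ ≤ n * ENNReal.ofReal (l / 2 ^ k) :=
    fun k y hy z hz => enorm_sub_le_of_mem_cube (hb' k ▸ hy) (hb' k ▸ hz)
  have hxQ : ∀ k, x ∈ Q k := fun k => rfl
  have hvol2 : ∀ k, volume (Q k) = 2 ^ n * volume (Q (k + 1)) := fun k => by
    rw [hvol, hvol, ← mul_pow]
    congr 1
    rw [← ENNReal.ofReal_ofNat, ← ENNReal.ofReal_mul (by norm_num)]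
    congr 1
    field_simp
    ring
  have hstep : ∀ k, edist (⨍ y in Q k, u y) (⨍ y in Q (k + 1), u y) ≤
      4 ^ n * n * (ENNReal.ofReal (l / 2 ^ k) *
        ((∫⁻ y in Q k, ‖fderiv ℝ u y‖ₑ) / volume (Q k))) := by
    intro k
    rw [edist_comm, edist_eq_enorm_sub]
    refine (enorm_setAverage_sub_setAverage_le (hsub k) (h0 _) (ht k) (hui k)).trans ?_
    have hP := lintegral_lintegral_enorm_sub_le (μ := volume) hu
      (hb' k ▸ measurableSet_cube _ _) (hb' k ▸ convex_cube _ _) (hdiam k)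
    rw [finrank_euclideanSpace_fin] at hP
    refine (mul_le_mul_right (mul_le_mul_right hP _) _).trans (le_of_eq ?_)
    have hinv : (volume (Q (k + 1)))⁻¹ = 2 ^ n * (volume (Q k))⁻¹ := by
      rw [hvol2 k, ENNReal.mul_inv (Or.inl (by simp)) (Or.inl (by simp)), ← mul_assoc,
        ENNReal.mul_inv_cancel (by simp) (by simp), one_mul]
    rw [hinv, ENNReal.div_eq_inv_mul]
    have h4 : (4 : ℝ≥0∞) ^ n = 2 ^ n * 2 ^ n := by
      rw [← mul_pow]
      norm_num
    calc _ = 2 ^ n * 2 ^ n * n * (ENNReal.ofReal (l / 2 ^ k) *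
          ((volume (Q k))⁻¹ * ∫⁻ y in Q k, ‖fderiv ℝ u y‖ₑ)) *
            ((volume (Q k))⁻¹ * volume (Q k)) := by ring
      _ = _ := by rw [ENNReal.inv_mul_cancel (h0 k) (ht k), mul_one, h4]
  have hlim : Tendsto (fun k => ⨍ y in Q k, u y) atTop (𝓝 (u x)) := by
    rw [tendsto_iff_edist_tendsto_0]
    have hgeo : Tendsto (fun k : ℕ => (L : ℝ≥0∞) * (n * ENNReal.ofReal (l / 2 ^ k))) atTop
        (𝓝 0) := by
      have h1 : Tendsto (fun k : ℕ => l / 2 ^ k) atTop (𝓝 0) :=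
        tendsto_const_nhds.div_atTop (tendsto_pow_atTop_atTop_of_one_lt one_lt_two)
      have h2 := ENNReal.tendsto_ofReal h1
      rw [ENNReal.ofReal_zero] at h2
      have h3 := ENNReal.Tendsto.const_mul (a := (L : ℝ≥0∞) * n) h2 (Or.inr (by finiteness))
      simpa only [mul_zero, mul_assoc] using h3
    refine tendsto_of_tendsto_of_tendsto_of_le_of_le tendsto_const_nhds hgeo
      (fun k => zero_le) fun k => ?_
    rw [edist_eq_enorm_sub]
    refine (enorm_setAverage_sub_le (h0 k) (ht k) (hui k) _).trans ?_
    have hQm : MeasurableSet (Q k) := hb' k ▸ measurableSet_cube _ _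
    have : ∫⁻ y in Q k, ‖u y - u x‖ₑ ≤
        ∫⁻ _ in Q k, (L : ℝ≥0∞) * (n * ENNReal.ofReal (l / 2 ^ k)) := by
      refine setLIntegral_mono' hQm fun y hy => ?_
      rw [← edist_eq_enorm_sub]
      refine (hu y x).trans ?_
      gcongr
      rw [edist_eq_enorm_sub]
      exact hdiam k x (hxQ k) y hy
    refine (mul_le_mul_right this _).trans (le_of_eq ?_)
    rw [setLIntegral_const, mul_comm, mul_assoc, ENNReal.mul_inv_cancel (h0 k) (ht k), mul_one]
  have hzero : Q 0 = Cube a l := dyadicCell_zero hl hx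
  have := edist_le_tsum_of_edist_le_of_tendsto₀ _ hstep hlim
  rw [ENNReal.tsum_mul_left, hzero, edist_comm, edist_eq_enorm_sub] at this
  exact this

end Telescoping

section Weighted

variable {n : ℕ}

theorem isDyadicSub_self (a : Rn n) (l : ℝ) : IsDyadicSub a l (Cube a l) :=
  ⟨0, fun _ => 0, by simp, by simp [Cube]⟩

theorem withDensity_restrict_apply_of_subset {w : Rn n → ℝ} {D E : Set (Rn n)}
    (hE : MeasurableSet E) (hED : E ⊆ D) :
    ((volume.restrict D).withDensity fun x => ENNReal.ofReal (w x)) E = wMass w E := by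
  rw [withDensity_apply _ hE, Measure.restrict_restrict hE, inter_eq_self_of_subset_left hED,
    wMass]

theorem measurableSet_dyadicCell (a : Rn n) (l : ℝ) (k : ℕ) (x : Rn n) :
    MeasurableSet {y | dyadicIndex a l k y = dyadicIndex a l k x} :=
  measurable_dyadicIndex a l k (measurableSet_singleton _)

theorem restrict_cube_dyadicCell_eq_zero {a : Rn n} {l : ℝ} (hl : 0 < l) {x : Rn n}
    (hx : x ∉ Cube a l) (k : ℕ) :
    volume.restrict (Cube a l) {y | dyadicIndex a l k y = dyadicIndex a l k x} = 0 := by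
  rw [Measure.restrict_apply (measurableSet_dyadicCell a l k x), dyadicCell_disjoint hl hx,
    measure_empty]

theorem IsAinftyD.withDensity_le {a : Rn n} {l : ℝ} (hl : 0 < l) {w : Rn n → ℝ} {C δ : ℝ}
    (h : IsAinftyD a l w C δ) (k : ℕ) (x : Rn n) {E : Set (Rn n)} (hE : MeasurableSet E)
    (hEQ : E ⊆ {y | dyadicIndex a l k y = dyadicIndex a l k x}) :
    ((volume.restrict (Cube a l)).withDensity fun x => ENNReal.ofReal (w x)) E ≤
      ENNReal.ofReal C * (volume.restrict (Cube a l) E /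
        volume.restrict (Cube a l) {y | dyadicIndex a l k y = dyadicIndex a l k x}) ^ δ *
      ((volume.restrict (Cube a l)).withDensity fun x => ENNReal.ofReal (w x))
        {y | dyadicIndex a l k y = dyadicIndex a l k x} := by
  have hQ := measurableSet_dyadicCell a l k x
  by_cases hx : x ∈ Cube a l
  · have hsub := dyadicCell_subset hl hx k
    rw [withDensity_restrict_apply_of_subset hE (hEQ.trans hsub),
      withDensity_restrict_apply_of_subset hQ hsub, Measure.restrict_apply hE,
      Measure.restrict_apply hQ, inter_eq_self_of_subset_left hsub,
      inter_eq_self_of_subset_left (hEQ.trans hsub)]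
    exact h _ (isDyadicSub_dyadicCell hl hx k) E hE hEQ
  · have h0 := measure_mono_null hEQ (restrict_cube_dyadicCell_eq_zero hl hx k)
    rw [withDensity_absolutelyContinuous _ _ h0]
    exact zero_le

theorem div_pow_rpow_eq {t : ℝ≥0∞} (h0 : t ≠ 0) (ht : t ≠ ∞) (hn : 0 < n) (q : ℝ) :
    (t / t ^ n) ^ q = (t ^ n) ^ (-(1 - 1 / (n : ℝ)) * q) := by
  have hn' : (n : ℝ) ≠ 0 := by positivity
  have : t / t ^ n = t ^ (1 - (n : ℝ)) := by
    rw [ENNReal.rpow_sub _ _ h0 ht, ENNReal.rpow_one, ENNReal.rpow_natCast]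
  rw [this, ← ENNReal.rpow_natCast, ← ENNReal.rpow_mul, ← ENNReal.rpow_mul]
  congr 1
  field_simp
  ring

theorem rpow_mul_rpow_le_of_le {p q : ℝ} (hp : 1 < p) (hpq : p ≤ q) {b W S M : ℝ≥0∞} {r : ℝ}
    (h : b ^ (r * p) * W ^ (p / q) * S ^ (p - 1) ≤ M) :
    b ^ (r * q) * W * S ^ (q * (1 - 1 / p)) ≤ M ^ (q / p) := by
  have hp0 : p ≠ 0 := by linarith
  have hq0 : q ≠ 0 := by linarith
  have hqp : 0 ≤ q / p := div_nonneg (by linarith) (by linarith)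
  refine le_trans (le_of_eq ?_) (ENNReal.rpow_le_rpow h hqp)
  rw [ENNReal.mul_rpow_of_nonneg _ _ hqp, ENNReal.mul_rpow_of_nonneg _ _ hqp,
    ← ENNReal.rpow_mul, ← ENNReal.rpow_mul, ← ENNReal.rpow_mul]
  have e1 : r * p * (q / p) = r * q := by field_simp
  have e2 : p / q * (q / p) = 1 := by field_simp
  have e3 : (p - 1) * (q / p) = q * (1 - 1 / p) := by field_simp
  rw [e1, e2, e3, ENNReal.rpow_one]

theorem ofReal_rpow_neg_mul_div_rpow {p : ℝ} (hp : 1 < p) {v : ℝ} (hv : 0 < v) (h : ℝ≥0∞) :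
    ENNReal.ofReal (v ^ (-(1 / (p - 1)))) *
      (h / ENNReal.ofReal (v ^ (-(1 / (p - 1))))) ^ p = h ^ p * ENNReal.ofReal v := by
  have hp1 : p - 1 ≠ 0 := by linarith
  have hs : 0 < v ^ (-(1 / (p - 1))) := Real.rpow_pos_of_pos hv _
  have hs0 : ENNReal.ofReal (v ^ (-(1 / (p - 1)))) ≠ 0 := (ENNReal.ofReal_pos.2 hs).ne'
  rw [ENNReal.div_rpow_of_nonneg _ _ (by linarith), div_eq_mul_inv (h ^ p), mul_left_comm,
    ← ENNReal.rpow_neg]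
  congr 1
  nth_rewrite 1 [← ENNReal.rpow_one (ENNReal.ofReal (v ^ (-(1 / (p - 1)))))]
  rw [← ENNReal.rpow_add _ _ hs0 ENNReal.ofReal_ne_top, ENNReal.ofReal_rpow_of_pos hs,
    ← Real.rpow_mul hv.le]
  have : -(1 / (p - 1)) * (1 + -p) = 1 := by
    field_simp
    ring
  rw [this, Real.rpow_one]

/-- The weighted inequality for globally Lipschitz functions. -/
theorem lintegral_enorm_sub_average_rpow_le (hn : 0 < n) {p q K Cw Cσ δw δσ : ℝ} (hp : 1 < p)
    (hpq : p ≤ q) (hδw : 0 < δw) (hδσ : 0 < δσ) {A : ℝ≥0∞} (hA : 1 ≤ A) (hA' : A ≠ ∞)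
    (hAw : ENNReal.ofReal Cw * A⁻¹ ^ δw ≤ 2⁻¹) (hAσ : ENNReal.ofReal Cσ * A⁻¹ ^ δσ ≤ 2⁻¹)
    {a : Rn n} {l : ℝ} (hl : 0 < l) {v w : Rn n → ℝ} (hwi : IntegrableOn w (Cube a l))
    (hwpos : ∀ᵐ x ∂(volume : Measure (Rn n)), x ∈ Cube a l → 0 < w x)
    (hvi : IntegrableOn v (Cube a l))
    (hvpos : ∀ᵐ x ∂(volume : Measure (Rn n)), x ∈ Cube a l → 0 < v x)
    (hw : IsAinftyD a l w Cw δw)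
    (hσ : IsAinftyD a l (fun x => v x ^ (-(1 / (p - 1)))) Cσ δσ)
    (hK : ∀ Q : Set (Rn n), IsDyadicSub a l Q →
      volume Q ^ (-(1 - 1 / (n : ℝ)) * p) * wMass w Q ^ (p / q) *
        wMass (fun x => v x ^ (-(1 / (p - 1)))) Q ^ (p - 1) ≤ ENNReal.ofReal K)
    {u : Rn n → ℝ} {L : ℝ≥0} (hu : LipschitzWith L u) :
    ∫⁻ x in Cube a l, ‖u x - ⨍ y in Cube a l, u y‖ₑ ^ q * ENNReal.ofReal (w x) ≤
      (4 ^ n * n) ^ q * (potentialConst p q A (ENNReal.ofReal K ^ (q / p)) *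
        (∫⁻ x in Cube a l, ‖fderiv ℝ u x‖ₑ ^ p * ENNReal.ofReal (v x)) ^ (q / p)) := by
  have hq0 : 0 < q := by linarith
  have hD := measurableSet_cube a l
  set σ : Rn n → ℝ := fun x => v x ^ (-(1 / (p - 1))) with hσdef
  set ν := volume.restrict (Cube a l) with hν
  set W : Rn n → ℝ≥0∞ := fun x => ENNReal.ofReal (w x) with hW
  set S : Rn n → ℝ≥0∞ := fun x => ENNReal.ofReal (σ x) with hS
  set h : Rn n → ℝ≥0∞ := fun x => ‖fderiv ℝ u x‖ₑ with hh
  have hhm : Measurable h := (measurable_fderiv ℝ u).enorm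
  have hhL : ∀ x, h x ≤ L := fun x => by
    have := norm_fderiv_le_of_lipschitz ℝ hu (x₀ := x)
    simp only [hh, enorm_eq_nnnorm]
    exact_mod_cast this
  have hvolD : volume (Cube a l) = ENNReal.ofReal l ^ n := volume_cube a l
  have hνfin : IsFiniteMeasure ν := ⟨by
    rw [hν, Measure.restrict_apply_univ, hvolD]
    finiteness⟩
  have hWm : AEMeasurable W ν := hwi.aemeasurable.ennreal_ofReal
  have hSm : AEMeasurable S ν :=
    (hvi.aemeasurable.pow_const (-(1 / (p - 1)))).ennreal_ofReal
  have hvν : ∀ᵐ x ∂ν, 0 < v x := (ae_restrict_iff' hD).2 hvpos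
  have hwν : ∀ᵐ x ∂ν, 0 < w x := (ae_restrict_iff' hD).2 hwpos
  set S' := hSm.mk S with hS'
  have hS'm : Measurable S' := hSm.measurable_mk
  have hSS' : S =ᵐ[ν] S' := hSm.ae_eq_mk
  set μ := ν.withDensity W with hμ
  set τ := ν.withDensity S' with hτ
  have hτS : τ = ν.withDensity S := withDensity_congr_ae hSS'.symm
  have hWD : ∫⁻ x, W x ∂ν ≠ ∞ := hwi.lintegral_lt_top.ne
  have hSD : ∫⁻ x, S x ∂ν ≠ ∞ := by
    intro htop
    have h1 := hK _ (isDyadicSub_self a l)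
    have hl0 : volume (Cube a l) ≠ 0 := by
      rw [hvolD]
      exact pow_ne_zero _ (ENNReal.ofReal_pos.2 hl).ne'
    have hlt : volume (Cube a l) ≠ ∞ := by
      rw [hvolD]
      finiteness
    have hW0 : wMass w (Cube a l) ≠ 0 := by
      intro h0
      rw [wMass, lintegral_eq_zero_iff' hWm] at h0
      have : ∀ᵐ x ∂ν, False := by
        filter_upwards [h0, hwν] with x h1 h2
        exact (ENNReal.ofReal_pos.2 h2).ne' h1
      rw [Filter.eventually_false_iff_eq_bot, ae_eq_bot, hν, Measure.restrict_eq_zero] at this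
      exact hl0 this
    have hWt : wMass w (Cube a l) ≠ ∞ := hWD
    have hSt : wMass σ (Cube a l) = ∞ := htop
    rw [hSt, ENNReal.top_rpow_of_pos (by linarith), ENNReal.mul_top] at h1
    · exact ENNReal.ofReal_ne_top (top_le_iff.1 h1)
    · refine mul_ne_zero ?_ ?_
      · exact (ENNReal.rpow_pos (pos_iff_ne_zero.2 hl0) hlt).ne'
      · exact (ENNReal.rpow_pos (pos_iff_ne_zero.2 hW0) hWt).ne'
  have hμfin : IsFiniteMeasure μ := isFiniteMeasure_withDensity hWD
  have hτfin : IsFiniteMeasure τ := hτS ▸ isFiniteMeasure_withDensity hSD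
  set f : Rn n → ℝ≥0∞ := fun x => h x / S' x with hf
  have hfm : Measurable f := hhm.div hS'm
  have hSpos : ∀ᵐ x ∂ν, S' x ≠ 0 ∧ S' x ≠ ∞ := by
    filter_upwards [hSS', hvν] with x hx hv
    rw [← hx]
    exact ⟨(ENNReal.ofReal_pos.2 (Real.rpow_pos_of_pos hv _)).ne', ENNReal.ofReal_ne_top⟩
  have hSf : S' * f =ᵐ[ν] h := by
    filter_upwards [hSpos] with x hx
    rw [Pi.mul_apply, hf, ENNReal.mul_div_cancel hx.1 hx.2]
  have hτf : τ.withDensity f = ν.withDensity h := by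
    rw [hτ, ← withDensity_mul _ hS'm hfm, withDensity_congr_ae hSf]
  have hfi : ∫⁻ x, f x ∂τ ≠ ∞ := by
    rw [hτ, lintegral_withDensity_eq_lintegral_mul _ hS'm hfm, lintegral_congr_ae hSf]
    refine ne_top_of_le_ne_top ?_ (lintegral_mono hhL)
    rw [lintegral_const]
    finiteness
  have hfp : ∫⁻ x, f x ^ p ∂τ = ∫⁻ x in Cube a l, h x ^ p * ENNReal.ofReal (v x) := by
    rw [hτ, lintegral_withDensity_eq_lintegral_mul _ hS'm (hfm.pow_const p)]
    refine lintegral_congr_ae ?_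
    filter_upwards [hSS', hvν] with x hx hv
    rw [Pi.mul_apply, hf]
    simp only
    rw [← hx]
    exact ofReal_rpow_neg_mul_div_rpow hp hv _
  have hKcell : ∀ k x, (ENNReal.ofReal (l / 2 ^ k) /
        ν {y | dyadicIndex a l k y = dyadicIndex a l k x}) ^ q *
      μ {y | dyadicIndex a l k y = dyadicIndex a l k x} *
      τ {y | dyadicIndex a l k y = dyadicIndex a l k x} ^ (q * (1 - 1 / p)) ≤
        ENNReal.ofReal K ^ (q / p) := by
    intro k x
    have hQ := measurableSet_dyadicCell a l k x
    by_cases hx : x ∈ Cube a l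
    · have hsub := dyadicCell_subset hl hx k
      rw [hτS, hμ, withDensity_restrict_apply_of_subset hQ hsub,
        withDensity_restrict_apply_of_subset hQ hsub, hν, Measure.restrict_apply hQ,
        inter_eq_self_of_subset_left hsub]
      have hvol : volume {y | dyadicIndex a l k y = dyadicIndex a l k x} =
          ENNReal.ofReal (l / 2 ^ k) ^ n := by
        obtain ⟨b, hb⟩ := dyadicCell_eq_cube a hl k x
        rw [hb, volume_cube]
      have h1 := hK _ (isDyadicSub_dyadicCell hl hx k)
      rw [hvol] at h1 ⊢
      rw [div_pow_rpow_eq (ENNReal.ofReal_pos.2 (by positivity)).ne' ENNReal.ofReal_ne_top hn]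
      exact rpow_mul_rpow_le_of_le hp hpq h1
    · have h0 : μ {y | dyadicIndex a l k y = dyadicIndex a l k x} = 0 :=
        withDensity_absolutelyContinuous _ _ (restrict_cube_dyadicCell_eq_zero hl hx k)
      rw [h0, mul_zero, zero_mul]
      exact zero_le
  have ht : ∀ k : ℕ, 2 * ENNReal.ofReal (l / 2 ^ (k + 1)) = ENNReal.ofReal (l / 2 ^ k) := by
    intro k
    rw [← ENNReal.ofReal_ofNat, ← ENNReal.ofReal_mul (by norm_num)]
    congr 1
    field_simp
    ring
  have main := lintegral_tsum_mul_cellAverage_rpow_le (ν := ν) (μ := μ) (τ := τ) hp hpq hA hA'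
    (measurable_dyadicIndex a l) (dyadicIndex_factorsThrough a l) hδw hδσ hAw hAσ
    (fun k x E hE hEQ => hw.withDensity_le hl k x hE hEQ)
    (fun k x E hE hEQ => by
      rw [hτS]
      exact hσ.withDensity_le hl k x hE hEQ) ht hKcell hfm hfi
  rw [hfp, hτf] at main
  have hum : Measurable fun x => ‖u x - ⨍ y in Cube a l, u y‖ₑ ^ q :=
    ((hu.continuous.measurable.sub_const _).enorm).pow_const q
  calc ∫⁻ x in Cube a l, ‖u x - ⨍ y in Cube a l, u y‖ₑ ^ q * ENNReal.ofReal (w x)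
      = ∫⁻ x, ‖u x - ⨍ y in Cube a l, u y‖ₑ ^ q ∂μ := by
        rw [hμ, lintegral_withDensity_eq_lintegral_mul₀ hWm hum.aemeasurable]
        refine lintegral_congr fun x => ?_
        rw [Pi.mul_apply, mul_comm]
    _ ≤ ∫⁻ x, (4 ^ n * n) ^ q * (∑' k, ENNReal.ofReal (l / 2 ^ k) *
          cellAverage (dyadicIndex a l) ν (ν.withDensity h) k x) ^ q ∂μ := by
        refine lintegral_mono_ae ?_
        have hmem : ∀ᵐ x ∂μ, x ∈ Cube a l :=
          (withDensity_absolutelyContinuous ν W).ae_le (ae_restrict_mem hD)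
        filter_upwards [hmem] with x hx
        rw [← ENNReal.mul_rpow_of_nonneg _ _ hq0.le]
        refine ENNReal.rpow_le_rpow ((enorm_sub_setAverage_le_tsum hl hu hx).trans
          (le_of_eq ?_)) hq0.le
        congr 1
        refine tsum_congr fun k => ?_
        have hQ := measurableSet_dyadicCell a l k x
        rw [cellAverage, withDensity_apply _ hQ, hν, Measure.restrict_restrict hQ,
          Measure.restrict_apply hQ, inter_eq_self_of_subset_left (dyadicCell_subset hl hx k)]
    _ = (4 ^ n * n) ^ q * ∫⁻ x, (∑' k, ENNReal.ofReal (l / 2 ^ k) *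
          cellAverage (dyadicIndex a l) ν (ν.withDensity h) k x) ^ q ∂μ :=
        lintegral_const_mul' _ _ (ENNReal.rpow_ne_top_of_nonneg hq0.le (by finiteness))
    _ ≤ _ := by gcongr

end Weighted

section Constants

/-- A threshold at which the power bound with constants `C, δ` drops below one half. -/
theorem ofReal_mul_inv_rpow_le_half {C δ B : ℝ} (hC : 0 < C) (hδ : 0 < δ)
    (hB : (2 * C) ^ (1 / δ) ≤ B) : ENNReal.ofReal C * (ENNReal.ofReal B)⁻¹ ^ δ ≤ 2⁻¹ := by
  have h0 : 0 < (2 * C) ^ (1 / δ) := by positivity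
  have hB0 : 0 < B := h0.trans_le hB
  have h1 : 2 * C ≤ B ^ δ := by
    have := Real.rpow_le_rpow h0.le hB hδ.le
    rwa [← Real.rpow_mul (by positivity), one_div_mul_cancel hδ.ne', Real.rpow_one] at this
  rw [← ENNReal.ofReal_inv_of_pos hB0, ENNReal.ofReal_rpow_of_pos (by positivity),
    ← ENNReal.ofReal_mul hC.le, ← ENNReal.ofReal_ofNat, ← ENNReal.ofReal_inv_of_pos two_pos]
  refine ENNReal.ofReal_le_ofReal ?_
  rw [Real.inv_rpow hB0.le, ← div_eq_mul_inv, div_le_iff₀ (by positivity)]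
  linarith

end Constants

section Extension

variable {n : ℕ}

theorem ae_mem_interior_cube (a : Rn n) (l : ℝ) :
    ∀ᵐ x ∂(volume : Measure (Rn n)), x ∈ Cube a l → x ∈ interior (Cube a l) := by
  have h : ∀ᵐ x ∂(volume : Measure (Rn n)), x ∉ frontier (Cube a l) :=
    measure_eq_zero_iff_ae_notMem.1 ((convex_cube a l).addHaar_frontier volume)
  filter_upwards [h] with x hx hxD
  by_contra hi
  exact hx ⟨subset_closure hxD, hi⟩

/-- An inequality between the weighted oscillation and the weighted gradient that holds for
globally Lipschitz functions holds for functions that are Lipschitz on the cube. -/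
theorem lintegral_enorm_sub_average_le_of_lipschitzOnWith {a : Rn n} {l p q : ℝ}
    {w v : Rn n → ℝ≥0∞} {P : ℝ≥0∞ → ℝ≥0∞ → Prop} {u : Rn n → ℝ} {L : ℝ≥0}
    (hu : LipschitzOnWith L u (Cube a l))
    (hP : ∀ g : Rn n → ℝ, LipschitzWith L g →
      P (∫⁻ x in Cube a l, ‖g x - ⨍ y in Cube a l, g y‖ₑ ^ q * w x)
        (∫⁻ x in Cube a l, ‖fderiv ℝ g x‖ₑ ^ p * v x)) :
    P (∫⁻ x in Cube a l, ‖u x - ⨍ y in Cube a l, u y‖ₑ ^ q * w x)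
      (∫⁻ x in Cube a l, ‖fderiv ℝ u x‖ₑ ^ p * v x) := by
  obtain ⟨g, hg, hug⟩ := hu.extend_real
  have hD := measurableSet_cube a l
  have havg : ⨍ y in Cube a l, u y = ⨍ y in Cube a l, g y := by
    rw [setAverage_eq, setAverage_eq, setIntegral_congr_fun hD hug]
  have h1 : ∫⁻ x in Cube a l, ‖u x - ⨍ y in Cube a l, u y‖ₑ ^ q * w x =
      ∫⁻ x in Cube a l, ‖g x - ⨍ y in Cube a l, g y‖ₑ ^ q * w x := by
    rw [havg]
    refine setLIntegral_congr_fun hD fun x hx => ?_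
    simp only [hug hx]
  have h2 : ∫⁻ x in Cube a l, ‖fderiv ℝ u x‖ₑ ^ p * v x =
      ∫⁻ x in Cube a l, ‖fderiv ℝ g x‖ₑ ^ p * v x := by
    refine lintegral_congr_ae ((ae_restrict_iff' hD).2 ?_)
    filter_upwards [ae_mem_interior_cube a l] with x hx hxD
    have : u =ᶠ[nhds x] g := Filter.eventuallyEq_of_mem
      (mem_interior_iff_mem_nhds.1 (hx hxD)) hug
    rw [this.fderiv_eq]
  rw [h1, h2]
  exact hP g hg

end Extension

/-- local two-weight Sobolev–Poincaré inequality: let `Q₀ ⊆ ℝ^n` be a cube,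
`1 < p ≤ q < ∞`, `w ∈ A_∞^d(Q₀)` with constants `Cw, δw`, and `σ = v^{−1/(p−1)} ∈ A_∞^d(Q₀)`
with constants `Cσ, δσ`. If `|Q|^{−(1−1/n)p} w(Q)^{p/q} σ(Q)^{p−1} ≤ K` for all dyadic
`Q ∈ D(Q₀)`, then for every Lipschitz function `u` on `Q₀`,
`(∫_{Q₀} |u − u_{Q₀}|^q w dx)^{1/q} ≤ C (∫_{Q₀} |∇u|^p v dx)^{1/p}` with
`C = C(n, p, q, K, Cw, Cσ, δw, δσ) > 0`. -/
theorem local_two_weight_sobolev_poincare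
    (n : ℕ) (hn : 0 < n) (p q K Cw Cσ δw δσ : ℝ) (hp : 1 < p) (hpq : p ≤ q)
    (hK : 0 < K) (hCw : 0 < Cw) (hδw : 0 < δw) (hCσ : 0 < Cσ) (hδσ : 0 < δσ) :
    ∃ C : ℝ, 0 < C ∧
      ∀ (a : Rn n) (l : ℝ), 0 < l →
      ∀ v w : Rn n → ℝ,
        IntegrableOn w (Cube a l) volume →
        (∀ᵐ x ∂(volume : Measure (Rn n)), x ∈ Cube a l → 0 < w x) →
        IntegrableOn v (Cube a l) volume →
        (∀ᵐ x ∂(volume : Measure (Rn n)), x ∈ Cube a l → 0 < v x) →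
        IsAinftyD a l w Cw δw →
        IsAinftyD a l (fun x => v x ^ (-(1 / (p - 1)))) Cσ δσ →
        (∀ Q : Set (Rn n), IsDyadicSub a l Q →
          volume Q ^ (-(1 - 1 / (n : ℝ)) * p) * wMass w Q ^ (p / q) *
              wMass (fun x => v x ^ (-(1 / (p - 1)))) Q ^ (p - 1) ≤ ENNReal.ofReal K) →
      ∀ (u : Rn n → ℝ) (L : ℝ≥0), LipschitzOnWith L u (Cube a l) →
        (∫⁻ x in Cube a l,
            (ENNReal.ofReal |u x - ⨍ y in Cube a l, u y|) ^ q * ENNReal.ofReal (w x)) ^ (1 / q) ≤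
          ENNReal.ofReal C *
            (∫⁻ x in Cube a l,
              (ENNReal.ofReal ‖fderiv ℝ u x‖) ^ p * ENNReal.ofReal (v x)) ^ (1 / p) := by
  have hq0 : 0 < q := by linarith
  set B := max 1 (max ((2 * Cw) ^ (1 / δw)) ((2 * Cσ) ^ (1 / δσ))) with hB
  have hB1 : 1 ≤ B := le_max_left _ _
  have hBw : (2 * Cw) ^ (1 / δw) ≤ B := (le_max_left _ _).trans (le_max_right _ _)
  have hBσ : (2 * Cσ) ^ (1 / δσ) ≤ B := (le_max_right _ _).trans (le_max_right _ _)
  have hA : 1 ≤ ENNReal.ofReal B := ENNReal.one_le_ofReal.2 hB1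
  have hKt : ENNReal.ofReal K ^ (q / p) ≠ ∞ :=
    ENNReal.rpow_ne_top_of_nonneg (div_nonneg (by linarith) (by linarith)) ENNReal.ofReal_ne_top
  set M := potentialConst p q (ENNReal.ofReal B) (ENNReal.ofReal K ^ (q / p)) with hM
  have hMt : M ≠ ∞ := potentialConst_ne_top hp hpq ENNReal.ofReal_ne_top hKt
  have hCt : 4 ^ n * n * M ^ (1 / q) ≠ ∞ :=
    ENNReal.mul_ne_top (by finiteness) (ENNReal.rpow_ne_top_of_nonneg (by positivity) hMt)
  refine ⟨(4 ^ n * n * M ^ (1 / q)).toReal + 1, by positivity, ?_⟩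
  intro a l hl v w hwi hwpos hvi hvpos hw hσ hKQ u L hu
  have hC : 4 ^ n * n * M ^ (1 / q) ≤
      ENNReal.ofReal ((4 ^ n * n * M ^ (1 / q)).toReal + 1) := by
    rw [ENNReal.le_ofReal_iff_toReal_le hCt (by positivity)]
    linarith
  simp only [← Real.norm_eq_abs, ofReal_norm]
  refine lintegral_enorm_sub_average_le_of_lipschitzOnWith
    (P := fun X Y => X ^ (1 / q) ≤
      ENNReal.ofReal ((4 ^ n * n * M ^ (1 / q)).toReal + 1) * Y ^ (1 / p)) hu fun g hg => ?_
  have main := lintegral_enorm_sub_average_rpow_le hn hp hpq hδw hδσ hA ENNReal.ofReal_ne_top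
    (ofReal_mul_inv_rpow_le_half hCw hδw hBw) (ofReal_mul_inv_rpow_le_half hCσ hδσ hBσ)
    hl hwi hwpos hvi hvpos hw hσ hKQ hg
  refine (ENNReal.rpow_le_rpow main (by positivity)).trans ?_
  have hq1 : 0 ≤ 1 / q := by positivity
  rw [ENNReal.mul_rpow_of_nonneg _ _ hq1, ENNReal.mul_rpow_of_nonneg _ _ hq1,
    ← ENNReal.rpow_mul, ← ENNReal.rpow_mul, mul_one_div_cancel hq0.ne', ENNReal.rpow_one,
    ← mul_assoc]
  have e : q / p * (1 / q) = 1 / p := by field_simp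
  rw [e]
  gcongr
end
end

section
/- Let w be a doubling weight in ℝ^n with constant D_1, and let Ω ⊂ ℝ^n be a bounded Boman domain with constant N ≥ 1 (with Whitney decomposition W(Ω) and a chain decomposition with central cube Q_0 satisfying the Boman chain condition). Then w is doubling in Ω, with constant D depending only on n, N, Ω, Q_0, and D_1; that is, w(Ω ∩ Q(x, 2r)) ≤ D · w(Ω ∩ Q(x, r)) for every cube Q(x, r) with midpoint x ∈ Ω. -/
open MeasureTheory ENNReal NNReal Set

noncomputable section

/-- The half-open cube `Q(x, r)` with midpoint `x` and side length `2r`. -/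
def CubeC {n : ℕ} (x : Rn n) (r : ℝ) : Set (Rn n) :=
  {y | ∀ i, x i - r ≤ y i ∧ y i < x i + r}

/-- The measure `w dx`. -/
def wMeasure {n : ℕ} (w : Rn n → ℝ) : Measure (Rn n) :=
  volume.withDensity fun x => ENNReal.ofReal (w x)

/-- The weighted average `u_{w;E} = w(E)⁻¹ ∫_E u w dx`. -/
def wAvg {n : ℕ} (w : Rn n → ℝ) (E : Set (Rn n)) (u : Rn n → ℝ) : ℝ :=
  ⨍ x in E, u x ∂(wMeasure w)

/-- A weight `w` is doubling in the open set `Ω` with constant `D`: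
`w(Ω ∩ Q(x,2r)) ≤ D w(Ω ∩ Q(x,r))` for every cube `Q(x,r)` with midpoint `x ∈ Ω`. -/
def DoublingIn {n : ℕ} (Ω : Set (Rn n)) (w : Rn n → ℝ) (D : ℝ) : Prop :=
  ∀ x ∈ Ω, ∀ r : ℝ, 0 < r →
    wMass w (Ω ∩ CubeC x (2 * r)) ≤ ENNReal.ofReal D * wMass w (Ω ∩ CubeC x r)

/-- The distance between two sets. -/
def setDist {n : ℕ} (A B : Set (Rn n)) : ℝ :=
  sInf {d : ℝ | ∃ x ∈ A, ∃ y ∈ B, d = dist x y}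

/-- A Whitney decomposition of `Ω` with dimensional constant `Cdim`: a countable family of
pairwise disjoint half-open cubes covering `Ω`, such that the side length of each dilated
cube `Q* = (9/8)Q` is comparable (with constant `Cdim`) to its distance from `∂Ω`, and the
dilated cubes have overlap bounded by `Cdim`. -/
structure WhitneyDecomp (n : ℕ) (Ω : Set (Rn n)) (Cdim : ℝ) where
  cubes : Set (Set (Rn n))
  countable : cubes.Countable
  center : Set (Rn n) → Rn n
  radius : Set (Rn n) → ℝ
  radius_pos : ∀ Q ∈ cubes, 0 < radius Q
  eq_cube : ∀ Q ∈ cubes, Q = CubeC (center Q) (radius Q)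
  pairwise_disjoint : cubes.PairwiseDisjoint id
  union_eq : ⋃₀ cubes = Ω
  dist_lower : ∀ Q ∈ cubes,
    9 / 4 * radius Q ≤ Cdim * setDist (CubeC (center Q) (9 / 8 * radius Q)) (frontier Ω)
  dist_upper : ∀ Q ∈ cubes,
    setDist (CubeC (center Q) (9 / 8 * radius Q)) (frontier Ω) ≤ Cdim * (9 / 4 * radius Q)
  overlap_finite : ∀ x : Rn n, {Q ∈ cubes | x ∈ CubeC (center Q) (9 / 8 * radius Q)}.Finite
  overlap_le : ∀ x : Rn n,
    (({Q ∈ cubes | x ∈ CubeC (center Q) (9 / 8 * radius Q)}).ncard : ℝ) ≤ Cdim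

/-- The dilated Whitney cube `Q* = (9/8)Q`. -/
def Qstar {n : ℕ} {Ω : Set (Rn n)} {Cdim : ℝ} (W : WhitneyDecomp n Ω Cdim)
    (Q : Set (Rn n)) : Set (Rn n) :=
  CubeC (W.center Q) (9 / 8 * W.radius Q)

/-- Two Whitney cubes `P, Q` are chained (with constant `c`) if there is a cube
`R ⊆ P* ∩ Q*` with `l(R) ≥ c · max{l(P*), l(Q*)}`. -/
def ChainLink {n : ℕ} {Ω : Set (Rn n)} {Cdim : ℝ} (W : WhitneyDecomp n Ω Cdim) (c : ℝ)
    (P Q : Set (Rn n)) : Prop :=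
  ∃ (z : Rn n) (r : ℝ), 0 < r ∧ CubeC z r ⊆ Qstar W P ∩ Qstar W Q ∧
    c * max (2 * (9 / 8 * W.radius P)) (2 * (9 / 8 * W.radius Q)) ≤ 2 * r

/-- `L` is a chain of Whitney cubes joining `P` to `Q`: a list of distinct Whitney cubes
starting at `P`, ending at `Q`, whose consecutive members are chained. -/
def IsChainFrom {n : ℕ} {Ω : Set (Rn n)} {Cdim : ℝ} (W : WhitneyDecomp n Ω Cdim) (c : ℝ)
    (P Q : Set (Rn n)) (L : List (Set (Rn n))) : Prop :=
  (∀ R ∈ L, R ∈ W.cubes) ∧ L.Nodup ∧ L.head? = some P ∧ L.getLast? = some Q ∧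
    L.Chain' (ChainLink W c)

/-- A Boman chain decomposition of `Ω` with constants `Cdim` (Whitney), `cdim` (chain link)
and `N` (Boman): a Whitney decomposition together with a chain decomposition with common
central cube such that the shadow of each `R` is contained in `NR`. -/
structure BomanDecomp (n : ℕ) (Ω : Set (Rn n)) (Cdim cdim N : ℝ)
    extends WhitneyDecomp n Ω Cdim where
  central : Set (Rn n)
  central_mem : central ∈ cubes
  chain : Set (Rn n) → List (Set (Rn n))
  chain_isChain : ∀ Q ∈ cubes, IsChainFrom toWhitneyDecomp cdim central Q (chain Q)
  shadow_subset : ∀ R ∈ cubes, ∀ Q ∈ cubes, R ∈ chain Q →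
    Q ⊆ CubeC (center R) (N * radius R)

theorem wMass_mono {n : ℕ} (w : Rn n → ℝ) {E F : Set (Rn n)} (h : E ⊆ F) :
    wMass w E ≤ wMass w F :=
  lintegral_mono_set h

theorem CubeC_mono {n : ℕ} (x : Rn n) {r s : ℝ} (h : r ≤ s) : CubeC x r ⊆ CubeC x s :=
  fun _ hy i => ⟨by linarith [(hy i).1], by linarith [(hy i).2]⟩

theorem mem_CubeC_self {n : ℕ} (x : Rn n) {r : ℝ} (hr : 0 < r) : x ∈ CubeC x r :=
  fun _ => ⟨by linarith, by linarith⟩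

/-- In positive dimension, a cube contained in another one has the smaller radius. -/
theorem radius_le_of_CubeC_subset {n : ℕ} (hn : 0 < n) {z x : Rn n} {r s : ℝ} (hr : 0 < r)
    (h : CubeC z r ⊆ CubeC x s) : r ≤ s := by
  by_contra! hlt
  set i : Fin n := ⟨0, hn⟩
  have corner : z - WithLp.toLp 2 (fun _ => r) ∈ CubeC z r := fun j => by
    constructor <;> simp <;> linarith
  have hz := (h corner i).1
  have far : z + WithLp.toLp 2 (fun _ => max 0 ((r + s) / 2)) ∈ CubeC z r := fun j => by
    have h1 := le_max_left 0 ((r + s) / 2)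
    have h2 : max 0 ((r + s) / 2) < r := max_lt hr (by linarith)
    constructor <;> simp only [PiLp.add_apply] <;> linarith
  have hz' := (h far i).2
  have h1 := le_max_right 0 ((r + s) / 2)
  simp only [PiLp.add_apply, PiLp.sub_apply] at hz hz'
  linarith

/-- Iterated doubling over all of space. -/
theorem wMass_CubeC_two_pow_mul_le {n : ℕ} {w : Rn n → ℝ} {D : ℝ}
    (hw : ∀ (x : Rn n) (r : ℝ), 0 < r →
      wMass w (CubeC x (2 * r)) ≤ ENNReal.ofReal D * wMass w (CubeC x r))
    (x : Rn n) {r : ℝ} (hr : 0 < r) (k : ℕ) :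
    wMass w (CubeC x (2 ^ k * r)) ≤ ENNReal.ofReal D ^ k * wMass w (CubeC x r) := by
  induction k with
  | zero => simp
  | succ k ih =>
    calc wMass w (CubeC x (2 ^ (k + 1) * r))
        = wMass w (CubeC x (2 * (2 ^ k * r))) := by congr 2; ring
      _ ≤ ENNReal.ofReal D * wMass w (CubeC x (2 ^ k * r)) := hw x _ (by positivity)
      _ ≤ ENNReal.ofReal D * (ENNReal.ofReal D ^ k * wMass w (CubeC x r)) := by gcongr
      _ = ENNReal.ofReal D ^ (k + 1) * wMass w (CubeC x r) := by rw [pow_succ]; ring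

/-- A chain whose last member satisfies `p` while its first does not contains a link entering
`p`. -/
theorem exists_link_entering {α : Type*} {R : α → α → Prop} {p : α → Prop} :
    ∀ (L : List α) {a b : α}, L.IsChain R → L.head? = some a → L.getLast? = some b →
      ¬ p a → p b → ∃ c ∈ L, ∃ d ∈ L, R c d ∧ ¬ p c ∧ p d
  | [], _, _, _, h, _, _, _ => by simp at h
  | [c], a, b, _, ha, hb, hpa, hpb => by
    simp only [List.head?_cons, List.getLast?_singleton, Option.some.injEq] at ha hb
    subst ha hb
    exact absurd hpb hpa
  | c :: d :: L, a, b, hL, ha, hb, hpa, hpb => by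
    simp only [List.head?_cons, Option.some.injEq] at ha
    subst ha
    rw [List.isChain_cons_cons] at hL
    by_cases hd : p d
    · exact ⟨c, by simp, d, by simp, hL.1, hpa, hd⟩
    · obtain ⟨e, he, f, hf, h⟩ := exists_link_entering (d :: L) hL.2 (by simp)
        (by simpa [List.getLast?_cons_cons] using hb) hd hpb
      exact ⟨e, List.mem_cons_of_mem _ he, f, List.mem_cons_of_mem _ hf, h⟩

/-- A cube contains, near each of its points `x`, a cube of any smaller radius `s` which is
contained in `Q(x, 2s)`. -/
theorem exists_CubeC_subset_inter {n : ℕ} {c x : Rn n} {ρ s : ℝ} (hs : 0 < s) (hsρ : s ≤ ρ)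
    (hx : x ∈ CubeC c ρ) : ∃ z : Rn n, CubeC z s ⊆ CubeC c ρ ∩ CubeC x (2 * s) := by
  have hρ : 0 < ρ := hs.trans_le hsρ
  obtain ⟨l, hl⟩ : ∃ l : ℝ, l = s / ρ := ⟨_, rfl⟩
  have hl0 : 0 ≤ l := hl ▸ by positivity
  have hl1 : l ≤ 1 := hl ▸ (div_le_one hρ).2 hsρ
  have hlρ : l * ρ = s := by rw [hl]; field_simp
  refine ⟨x + l • (c - x), fun y hy => ⟨fun i => ?_, fun i => ?_⟩⟩ <;>
  · obtain ⟨h1, h2⟩ := hy i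
    obtain ⟨h3, h4⟩ := hx i
    simp only [PiLp.add_apply, PiLp.smul_apply, PiLp.sub_apply, smul_eq_mul] at h1 h2
    constructor <;> nlinarith

/-- A Whitney cube of a chain ending at `Q ∋ x` lies in every cube centred at `x` of radius at
least `N + 1` times its own. -/
theorem BomanDecomp.subset_CubeC_of_mem_chain {n : ℕ} {Ω : Set (Rn n)} {Cdim cdim N : ℝ}
    (B : BomanDecomp n Ω Cdim cdim N) {x : Rn n} {r : ℝ} {P Q : Set (Rn n)}
    (hP : P ∈ B.cubes) (hQ : Q ∈ B.cubes) (hPQ : P ∈ B.chain Q) (hx : x ∈ Q)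
    (hr : (N + 1) * B.radius P ≤ r) :
    CubeC (B.center P) (B.radius P) ⊆ Ω ∩ CubeC x r := by
  have hxP := B.shadow_subset P hP Q hQ hPQ hx
  refine fun y hy => ⟨?_, fun i => ?_⟩
  · rw [← B.union_eq]
    exact ⟨P, hP, by rwa [B.eq_cube P hP]⟩
  · constructor <;> linarith [(hy i).1, (hy i).2, (hxP i).1, (hxP i).2]

/-- A Boman domain contains, up to any bounded scale, a cube of comparable size in each cube
centred in the domain. -/
theorem BomanDecomp.exists_CubeC_subset {n : ℕ} (hn : 0 < n) {Ω : Set (Rn n)}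
    {Cdim cdim N : ℝ} (hN : 0 ≤ N) (hcdim : 0 < cdim) (B : BomanDecomp n Ω Cdim cdim N)
    {M : ℝ} (hM : 0 < M) :
    ∃ κ : ℝ, 0 < κ ∧ ∀ x ∈ Ω, ∀ r : ℝ, 0 < r → r ≤ M →
      ∃ (z : Rn n) (t : ℝ), κ * r ≤ t ∧ CubeC z t ⊆ Ω ∩ CubeC x r := by
  have hR := B.radius_pos _ B.central_mem
  set R := B.radius B.central
  refine ⟨min (min 1 cdim / (2 * (N + 1))) (R / M), by positivity, fun x hx r hr hrM => ?_⟩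
  set κ := min (min 1 cdim / (2 * (N + 1))) (R / M)
  obtain ⟨s, hs⟩ : ∃ s : ℝ, s = r / (2 * (N + 1)) := ⟨_, rfl⟩
  have hs0 : 0 < s := hs ▸ by positivity
  have hsr : 2 * ((N + 1) * s) = r := by rw [hs]; field_simp
  have hκs : κ * r ≤ min 1 cdim * s := by
    calc κ * r ≤ min 1 cdim / (2 * (N + 1)) * r := by gcongr; exact min_le_left _ _
      _ = min 1 cdim * s := by rw [hs]; ring
  have hκ1 : κ * r ≤ s := hκs.trans (by nlinarith [min_le_left 1 cdim])
  have hκc : κ * r ≤ cdim * s := hκs.trans (by gcongr; exact min_le_right _ _)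
  have hκR : κ * r ≤ R := by
    calc κ * r ≤ R / M * M := by gcongr; exact min_le_right _ _
      _ = R := by field_simp
  rw [← B.union_eq] at hx
  obtain ⟨Q, hQ, hxQ⟩ := hx
  obtain ⟨hmem, -, hhead, hlast, hchain⟩ := B.chain_isChain Q hQ
  have small : ∀ P ∈ B.chain Q, B.radius P ≤ s →
      CubeC (B.center P) (B.radius P) ⊆ Ω ∩ CubeC x r := fun P hP hPs =>
    B.subset_CubeC_of_mem_chain (hmem P hP) hQ hP hxQ (by nlinarith)
  rcases lt_or_ge s (B.radius Q) with hQs | hQs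
  · rw [B.eq_cube Q hQ] at hxQ
    obtain ⟨z, hz⟩ := exists_CubeC_subset_inter hs0 hQs.le hxQ
    refine ⟨z, s, hκ1, hz.trans (inter_subset_inter ?_ (CubeC_mono x (by nlinarith)))⟩
    rw [← B.eq_cube Q hQ, ← B.union_eq]
    exact subset_sUnion_of_mem hQ
  rcases le_or_gt R s with hRs | hRs
  · exact ⟨_, _, hκR, small B.central (List.mem_of_mem_head? hhead) hRs⟩
  · obtain ⟨P, -, P', hP', ⟨z, t, ht, hsub, hle⟩, hPs, hPs'⟩ :=
      exists_link_entering (p := fun P => B.radius P ≤ s) _ hchain hhead hlast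
        (not_le.2 hRs) hQs
    have htP' : t ≤ 9 / 8 * B.radius P' :=
      radius_le_of_CubeC_subset hn ht (hsub.trans inter_subset_right)
    have hcP : cdim * (2 * (9 / 8 * B.radius P)) ≤ 2 * t :=
      (mul_le_mul_of_nonneg_left (le_max_left _ _) hcdim.le).trans hle
    have hcs : cdim * s ≤ cdim * B.radius P :=
      mul_le_mul_of_nonneg_left (not_le.1 hPs).le hcdim.le
    exact ⟨_, _, by linarith, small P' hP' hPs'⟩

/-- A bounded set is contained in all sufficiently large cubes centred at its points. -/
theorem exists_subset_CubeC_of_isBounded {n : ℕ} {Ω : Set (Rn n)}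
    (hΩ : Bornology.IsBounded Ω) :
    ∃ M : ℝ, 0 < M ∧ ∀ x ∈ Ω, ∀ r : ℝ, M < r → Ω ⊆ CubeC x r := by
  obtain ⟨C, hC⟩ := Metric.isBounded_iff.1 hΩ
  refine ⟨max 1 C, by positivity, fun x hx r hr y hy i => ?_⟩
  have h1 : |y i - x i| ≤ dist y x := by
    simpa [dist_eq_norm] using PiLp.norm_apply_le (y - x) i
  have h2 : |y i - x i| < r := (h1.trans (hC hy hx)).trans_lt ((le_max_right _ _).trans_lt hr)
  obtain ⟨h3, h4⟩ := abs_lt.1 h2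
  constructor <;> linarith

/-- a weight that is doubling in `ℝ^n` with constant `D₁` is doubling in a
bounded Boman domain `Ω`, with a constant `D = D(n, N, Ω, Q₀, D₁)`, where `Q₀` is the
central cube of the chain decomposition. -/
theorem doubling_on_Rn_implies_doubling_on_boman
    (n : ℕ) (hn : 0 < n) (N Cdim cdim : ℝ) (hN : 1 ≤ N) (hCdim : 0 < Cdim)
    (hcdim : 0 < cdim) (Ω : Set (Rn n)) (hΩo : IsOpen Ω) (hΩc : IsConnected Ω)
    (hΩb : Bornology.IsBounded Ω) (B : BomanDecomp n Ω Cdim cdim N)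
    (D₁ : ℝ) (hD₁ : 0 < D₁) :
    ∃ D : ℝ, 0 < D ∧
      ∀ w : Rn n → ℝ, LocallyIntegrable w volume →
        (∀ᵐ x ∂(volume : Measure (Rn n)), 0 < w x) →
        (∀ (x : Rn n) (r : ℝ), 0 < r →
          wMass w (CubeC x (2 * r)) ≤ ENNReal.ofReal D₁ * wMass w (CubeC x r)) →
        DoublingIn Ω w D := by
  obtain ⟨M, hM, hΩM⟩ := exists_subset_CubeC_of_isBounded hΩb
  obtain ⟨κ, hκ, hcube⟩ := B.exists_CubeC_subset hn (by linarith) hcdim hM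
  obtain ⟨k, hk⟩ := pow_unbounded_of_one_lt (4 / κ) (one_lt_two (α := ℝ))
  refine ⟨max 1 (D₁ ^ k), by positivity, fun w _ _ hw x hx r hr => ?_⟩
  rcases le_or_gt r M with hrM | hrM
  · obtain ⟨z, t, ht, hz⟩ := hcube x hx r hr hrM
    have ht0 : 0 < t := (mul_pos hκ hr).trans_le ht
    have hzx := (hz (mem_CubeC_self z ht0)).2
    have h4 : 4 * r ≤ 2 ^ k * t := by
      calc 4 * r = 4 / κ * (κ * r) := by field_simp
        _ ≤ 2 ^ k * t := by gcongr
    calc wMass w (Ω ∩ CubeC x (2 * r)) ≤ wMass w (CubeC z (2 ^ k * t)) :=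
          wMass_mono w fun y hy i => by
            constructor <;> linarith [(hzx i).1, (hzx i).2, (hy.2 i).1, (hy.2 i).2]
      _ ≤ ENNReal.ofReal D₁ ^ k * wMass w (CubeC z t) :=
          wMass_CubeC_two_pow_mul_le hw z ht0 k
      _ ≤ ENNReal.ofReal (max 1 (D₁ ^ k)) * wMass w (Ω ∩ CubeC x r) := by
          rw [← ENNReal.ofReal_pow hD₁.le]
          exact mul_le_mul' (ENNReal.ofReal_le_ofReal (le_max_right _ _)) (wMass_mono w hz)
  · calc wMass w (Ω ∩ CubeC x (2 * r)) ≤ 1 * wMass w (Ω ∩ CubeC x r) := by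
          rw [one_mul]
          exact wMass_mono w fun y hy => ⟨hy.1, hΩM x hx r hrM hy.1⟩
      _ ≤ ENNReal.ofReal (max 1 (D₁ ^ k)) * wMass w (Ω ∩ CubeC x r) := by
          gcongr
          exact ENNReal.one_le_ofReal.2 (le_max_left _ _)
end
end
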